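/- Let S = x₁,…,x_s with s > 0 be a principal (+)-admissible sequence on (Γ,Λ). The following are equivalent: (a) there exists an indecomposable preprojective k(Γ,Λ)-module M satisfying S ∼ S_M; (b) the word w(S) ∈ W is reduced; (c) for every i with 0 < i < s, the vector σ_{x_i}σ_{x_{i+1}}⋯σ_{x_{s−1}}(e_{x_s}) ∈ ℤⁿ has all coordinates nonnegative (and is nonzero). -/

import Mathlib

namespace KP

/-! ## Quivers on a fixed vertex set `Fin n`.

An orientation is encoded by `Λ : Fin n → Fin n → ℕ`, where `Λ a b` is the number of
arrows from `a` to `b`.  The underlying graph is recorded by `edges Λ a b = Λ a b + Λ b a`. -/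

/-- The orientation `σ_x Λ` obtained by reversing every arrow incident with `x`. -/
def flipO {n : ℕ} (x : Fin n) (Λ : Fin n → Fin n → ℕ) : Fin n → Fin n → ℕ :=
  fun a b => if a = x ∨ b = x then Λ b a else Λ a b

/-- Number of edges of the underlying graph joining `a` and `b`. -/
def edges {n : ℕ} (Λ : Fin n → Fin n → ℕ) (a b : Fin n) : ℕ := Λ a b + Λ b a

/-- `x` is a sink: no arrow starts at `x`. -/
def IsSink {n : ℕ} (Λ : Fin n → Fin n → ℕ) (x : Fin n) : Prop := ∀ y, Λ x y = 0

/-- `S` is a `(+)`-admissible sequence of vertices on `(Γ, Λ)`. -/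
def Admissible {n : ℕ} (Λ : Fin n → Fin n → ℕ) : List (Fin n) → Prop
  | [] => True
  | x :: xs => IsSink Λ x ∧ Admissible (flipO x Λ) xs

/-- The orientation `Λ^S`. -/
def orientAfter {n : ℕ} (Λ : Fin n → Fin n → ℕ) : List (Fin n) → (Fin n → Fin n → ℕ)
  | [] => Λ
  | x :: xs => orientAfter (flipO x Λ) xs

/-- Elementary move: interchange two consecutive vertices not joined by an edge. -/
inductive SwapRel {n : ℕ} (E : Fin n → Fin n → ℕ) : List (Fin n) → List (Fin n) → Prop
  | swap (l₁ l₂ : List (Fin n)) (a b : Fin n) (h : E a b = 0) :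
      SwapRel E (l₁ ++ a :: b :: l₂) (l₁ ++ b :: a :: l₂)

/-- The equivalence `∼` on sequences of vertices: reflexive–transitive closure of the
(symmetric) relation `SwapRel`. -/
def Sim {n : ℕ} (E : Fin n → Fin n → ℕ) : List (Fin n) → List (Fin n) → Prop :=
  Relation.ReflTransGen (SwapRel E)

/-- The preorder `S ⪯ T` : `T ∼ S ++ U` for some `(+)`-admissible sequence `U` on `(Γ, Λ^S)`. -/
def Preceq {n : ℕ} (Λ : Fin n → Fin n → ℕ) (S T : List (Fin n)) : Prop :=
  ∃ U, Admissible (orientAfter Λ S) U ∧ Sim (edges Λ) T (S ++ U)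

/-- Support of a sequence of vertices. -/
def suppOf {n : ℕ} (S : List (Fin n)) : Set (Fin n) := {v | v ∈ S}

/-- The partial order on vertices: `x ≤ y` iff there is a path from `x` to `y` in `(Γ, Λ)`. -/
def PathLE {n : ℕ} (Λ : Fin n → Fin n → ℕ) (x y : Fin n) : Prop :=
  Relation.ReflTransGen (fun a b => Λ a b ≠ 0) x y

/-- A filter (up-closed set) of the poset `(Γ₀, Λ)`. -/
def IsFilter {n : ℕ} (Λ : Fin n → Fin n → ℕ) (F : Set (Fin n)) : Prop :=
  ∀ x ∈ F, ∀ y, PathLE Λ x y → y ∈ F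

/-- The principal filter `⟨x⟩`. -/
def upSet {n : ℕ} (Λ : Fin n → Fin n → ℕ) (x : Fin n) : Set (Fin n) := {y | PathLE Λ x y}

/-- The hull `H_Λ(F)`: the smallest filter containing `F` and every vertex joined
by an edge to a vertex of `F`. -/
def hull {n : ℕ} (Λ : Fin n → Fin n → ℕ) (F : Set (Fin n)) : Set (Fin n) :=
  {y | ∃ x, (x ∈ F ∨ ∃ z ∈ F, edges Λ z x ≠ 0) ∧ PathLE Λ x y}

/-- `segs` is a canonical form of `S` (Proposition 2.1): `S ∼ S₁S₂⋯S_r`, each segment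
consists of distinct vertices, is nonempty, and `Supp S_i = Supp (S_i S_{i+1} ⋯ S_r)`. -/
def Segments {n : ℕ} (Λ : Fin n → Fin n → ℕ) (S : List (Fin n))
    (segs : List (List (Fin n))) : Prop :=
  Admissible Λ segs.flatten ∧ Sim (edges Λ) S segs.flatten ∧
  (∀ seg ∈ segs, seg ≠ [] ∧ seg.Nodup) ∧
  ∀ i, i < segs.length → suppOf (segs.getD i []) = suppOf ((segs.drop i).flatten)

/-- `J` is (a representative of) the join `S ∨ T` (Definition 2.4):  the canonical form of `J`
has `Supp R_i = Supp S_i ∪ Supp T_i` (out-of-range segments read as `∅`). -/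
def IsJoin {n : ℕ} (Λ : Fin n → Fin n → ℕ) (S T J : List (Fin n)) : Prop :=
  ∃ CS CT CJ, Segments Λ S CS ∧ Segments Λ T CT ∧ Segments Λ J CJ ∧
    ∀ i, suppOf (CJ.getD i []) = suppOf (CS.getD i []) ∪ suppOf (CT.getD i [])

/-- `M` is (a representative of) the meet `S ∧ T` (Definition 2.4). -/
def IsMeet {n : ℕ} (Λ : Fin n → Fin n → ℕ) (S T M : List (Fin n)) : Prop :=
  ∃ CS CT CM, Segments Λ S CS ∧ Segments Λ T CT ∧ Segments Λ M CM ∧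
    ∀ i, suppOf (CM.getD i []) = suppOf (CS.getD i []) ∩ suppOf (CT.getD i [])

/-- `S` is (equivalent to) the join `T₁ ∨ ⋯ ∨ T_l` of the list of sequences `Ts`. -/
def IsJoinList {n : ℕ} (Λ : Fin n → Fin n → ℕ) : List (List (Fin n)) → List (Fin n) → Prop
  | [], S => S = []
  | T :: Ts, S => ∃ J, IsJoinList Λ Ts J ∧ IsJoin Λ T J S

/-- The segments of a canonical form of a principal sequence `S_{r,x}` (Definition 3.1). -/
def PrincipalSegs {n : ℕ} (Λ : Fin n → Fin n → ℕ) (segs : List (List (Fin n)))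
    (r : ℕ) (x : Fin n) : Prop :=
  segs.length = r ∧ 0 < r ∧
  (∀ i, i + 1 < r → suppOf (segs.getD i []) = hull Λ (suppOf (segs.getD (i+1) []))) ∧
  suppOf (segs.getD (r-1) []) = upSet Λ x

/-- `S ∼ S_{r,x}`, the principal `(+)`-admissible sequence of size `r` with
`Supp S_r = ⟨x⟩`. -/
def IsPrincipalSeq {n : ℕ} (Λ : Fin n → Fin n → ℕ) (r : ℕ) (x : Fin n)
    (S : List (Fin n)) : Prop :=
  ∃ segs, Segments Λ S segs ∧ PrincipalSegs Λ segs r x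

/-- `S` is a principal `(+)`-admissible sequence. -/
def IsPrincipal {n : ℕ} (Λ : Fin n → Fin n → ℕ) (S : List (Fin n)) : Prop :=
  ∃ r x, IsPrincipalSeq Λ r x S


/-! ## Representations of `(Γ, Λ)` over a field `k`. -/

/-- A (finite-dimensional) representation of the quiver `(Γ, Λ)` over `k`:
the space at vertex `x` is `Fin (d x) → k`, and each arrow carries a linear map. -/
structure Rep (k : Type) [Field k] (n : ℕ) (Λ : Fin n → Fin n → ℕ) where
  d : Fin n → ℕ
  f : ∀ a b : Fin n, Fin (Λ a b) → ((Fin (d a) → k) →ₗ[k] (Fin (d b) → k))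

variable {k : Type} [Field k] {n : ℕ}

/-- A morphism of representations. -/
structure RepHom {Λ : Fin n → Fin n → ℕ} (M N : Rep k n Λ) where
  g : ∀ x, (Fin (M.d x) → k) →ₗ[k] (Fin (N.d x) → k)
  comm : ∀ a b i v, g b (M.f a b i v) = N.f a b i (g a v)

/-- Isomorphism of representations. -/
def RepIso {Λ : Fin n → Fin n → ℕ} (M N : Rep k n Λ) : Prop :=
  ∃ g : ∀ x, (Fin (M.d x) → k) ≃ₗ[k] (Fin (N.d x) → k),
    ∀ a b i v, g b (M.f a b i v) = N.f a b i (g a v)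

/-- The zero representation. -/
def IsZeroRep {Λ : Fin n → Fin n → ℕ} (M : Rep k n Λ) : Prop := ∀ x, M.d x = 0

/-- Cast between the standard spaces. -/
def castL (k : Type) [Field k] {m m' : ℕ} (h : m = m') : (Fin m → k) ≃ₗ[k] (Fin m' → k) :=
  LinearEquiv.funCongrLeft k k (finCongr h.symm)

/-- The splitting `(Fin (m + p) → k) ≃ₗ (Fin m → k) × (Fin p → k)`. -/
def splitL (k : Type) [Field k] (m p : ℕ) : (Fin (m + p) → k) ≃ₗ[k] (Fin m → k) × (Fin p → k) :=
  (LinearEquiv.funCongrLeft k k finSumFinEquiv).trans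
    (LinearEquiv.sumArrowLequivProdArrow _ _ k k)

/-- Direct sum of two representations. -/
def dSum {Λ : Fin n → Fin n → ℕ} (M N : Rep k n Λ) : Rep k n Λ where
  d x := M.d x + N.d x
  f a b i :=
    (splitL k (M.d b) (N.d b)).symm.toLinearMap ∘ₗ
      (LinearMap.prodMap (M.f a b i) (N.f a b i)) ∘ₗ (splitL k (M.d a) (N.d a)).toLinearMap

/-- The zero representation (as an object). -/
def zeroRep (k : Type) [Field k] (n : ℕ) (Λ : Fin n → Fin n → ℕ) : Rep k n Λ where
  d _ := 0
  f _ _ _ := 0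

/-- Direct sum of a list of representations. -/
def dSumList {Λ : Fin n → Fin n → ℕ} (L : List (Rep k n Λ)) : Rep k n Λ :=
  L.foldr dSum (zeroRep k n Λ)

/-- `M` is indecomposable. -/
def Indecomp {Λ : Fin n → Fin n → ℕ} (M : Rep k n Λ) : Prop :=
  ¬ IsZeroRep M ∧ ∀ A B : Rep k n Λ, RepIso M (dSum A B) → IsZeroRep A ∨ IsZeroRep B

/-- `X` is a direct summand of `M`. -/
def IsSummand {Λ : Fin n → Fin n → ℕ} (X M : Rep k n Λ) : Prop :=
  ∃ Y, RepIso M (dSum X Y)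

/-! ### Reflection functors (on objects) -/

/-- Index type of the arrows ending at `x`. -/
abbrev Arin {n : ℕ} (Λ : Fin n → Fin n → ℕ) (x : Fin n) := Σ y : Fin n, Fin (Λ y x)

/-- Index type of the arrows starting at `x`. -/
abbrev Aout {n : ℕ} (Λ : Fin n → Fin n → ℕ) (x : Fin n) := Σ y : Fin n, Fin (Λ x y)

/-- The map `h : ⊕_{a : y → x} V(y) → V(x)` induced by the maps along the arrows ending at `x`. -/
noncomputable def inMap (Λ : Fin n → Fin n → ℕ) (M : Rep k n Λ) (x : Fin n) :
    ((p : Arin Λ x) → (Fin (M.d p.1) → k)) →ₗ[k] (Fin (M.d x) → k) :=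
  ∑ p : Arin Λ x, (M.f p.1 x p.2) ∘ₗ LinearMap.proj p

/-- The map `h' : V(x) → ⊕_{a : x → y} V(y)` induced by the maps along arrows starting at `x`. -/
def outMap (Λ : Fin n → Fin n → ℕ) (M : Rep k n Λ) (x : Fin n) :
    (Fin (M.d x) → k) →ₗ[k] ((p : Aout Λ x) → (Fin (M.d p.1) → k)) :=
  LinearMap.pi fun p => M.f x p.1 p.2

noncomputable def kerEquiv (Λ : Fin n → Fin n → ℕ) (M : Rep k n Λ) (x : Fin n) :
    LinearMap.ker (inMap Λ M x) ≃ₗ[k]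
      (Fin (Module.finrank k (LinearMap.ker (inMap Λ M x))) → k) :=
  (Module.finBasis k _).equivFun

noncomputable def cokerEquiv (Λ : Fin n → Fin n → ℕ) (M : Rep k n Λ) (x : Fin n) :
    (((p : Aout Λ x) → (Fin (M.d p.1) → k)) ⧸ LinearMap.range (outMap Λ M x)) ≃ₗ[k]
      (Fin (Module.finrank k (((p : Aout Λ x) → (Fin (M.d p.1) → k)) ⧸
        LinearMap.range (outMap Λ M x))) → k) :=
  (Module.finBasis k _).equivFun

/-- The positive reflection functor `F_x⁺` (on objects): the space at `x` is replaced
by the kernel of `inMap`, with the maps along the reversed arrows induced by inclusion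
followed by the projections. -/
noncomputable def reflPlus (x : Fin n) (Λ : Fin n → Fin n → ℕ) (M : Rep k n Λ) :
    Rep k n (flipO x Λ) where
  d z := if z = x then Module.finrank k (LinearMap.ker (inMap Λ M x)) else M.d z
  f a b i :=
    if ha : a = x then
      if hb : b = x then 0
      else
        (castL k (if_neg hb).symm).toLinearMap ∘ₗ
          (LinearMap.proj (φ := fun p : Arin Λ x => Fin (M.d p.1) → k)
            (⟨b, Fin.cast (by subst ha; simp [flipO]) i⟩ : Arin Λ x)) ∘ₗ
          (LinearMap.ker (inMap Λ M x)).subtype ∘ₗ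
          (kerEquiv Λ M x).symm.toLinearMap ∘ₗ (castL k (if_pos ha)).toLinearMap
    else
      if hb : b = x then 0
      else
        (castL k (if_neg hb).symm).toLinearMap ∘ₗ
          M.f a b (Fin.cast (by simp [flipO, ha, hb]) i) ∘ₗ
          (castL k (if_neg ha)).toLinearMap

/-- The negative reflection functor `F_x⁻` (on objects), presented as a map from
representations of `(Γ, σ_x Λ)` to representations of `(Γ, Λ)`: the space at `x` is
replaced by the cokernel of `outMap`. -/
noncomputable def reflMinus (x : Fin n) (Λ : Fin n → Fin n → ℕ)
    (N : Rep k n (flipO x Λ)) : Rep k n Λ where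
  d z := if z = x then
      Module.finrank k (((p : Aout (flipO x Λ) x) → (Fin (N.d p.1) → k)) ⧸
        LinearMap.range (outMap (flipO x Λ) N x))
    else N.d z
  f a b i :=
    if hb : b = x then
      if ha : a = x then 0
      else
        (castL k (if_pos hb).symm).toLinearMap ∘ₗ
          (cokerEquiv (flipO x Λ) N x).toLinearMap ∘ₗ
          (LinearMap.range (outMap (flipO x Λ) N x)).mkQ ∘ₗ
          (LinearMap.single k (fun p : Aout (flipO x Λ) x => Fin (N.d p.1) → k)
            (⟨a, Fin.cast (by subst hb; simp [flipO]) i⟩ : Aout (flipO x Λ) x)) ∘ₗ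
          (castL k (if_neg ha)).toLinearMap
    else
      if ha : a = x then 0
      else
        (castL k (if_neg hb).symm).toLinearMap ∘ₗ
          N.f a b (Fin.cast (by simp [flipO, ha, hb]) i) ∘ₗ
          (castL k (if_neg ha)).toLinearMap

/-- `F(S) = F_{x_s}⁺ ⋯ F_{x_1}⁺` applied to a representation. -/
noncomputable def FList : (S : List (Fin n)) → (Λ : Fin n → Fin n → ℕ) → Rep k n Λ →
    Rep k n (orientAfter Λ S)
  | [], _, M => M
  | x :: xs, Λ, M => FList xs (flipO x Λ) (reflPlus x Λ M)

/-- `S` annihilates `M` : `F(S) M = 0`. -/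
def Annihilates (Λ : Fin n → Fin n → ℕ) (S : List (Fin n)) (M : Rep k n Λ) : Prop :=
  IsZeroRep (FList S Λ M)

/-- `M` is preprojective: some `(+)`-admissible sequence annihilates it. -/
def Preprojective (Λ : Fin n → Fin n → ℕ) (M : Rep k n Λ) : Prop :=
  ∃ S, Admissible Λ S ∧ Annihilates Λ S M

/-- `S` is a shortest `(+)`-admissible sequence annihilating `M` : it annihilates `M` and no
proper subsequence of `S` annihilates `M`.  (This predicate is invariant under `∼`, so it
expresses `S ∼ S_M`.) -/
def IsShortestAnn (Λ : Fin n → Fin n → ℕ) (M : Rep k n Λ) (S : List (Fin n)) : Prop :=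
  Admissible Λ S ∧ Annihilates Λ S M ∧
  ∀ S', Admissible Λ S' → Annihilates Λ S' M → Preceq Λ S' S → Sim (edges Λ) S' S

/-- The simple representation `L_x` concentrated at the vertex `x`. -/
def simpleRep (Λ : Fin n → Fin n → ℕ) (x : Fin n) : Rep k n Λ where
  d z := if z = x then 1 else 0
  f _ _ _ := 0

/-- `M(S) = F_{x₁}⁻ F_{x₂}⁻ ⋯ F_{x_{s-1}}⁻ (L_{x_s})`, where `L_{x_s}` is the simple
(projective) module over `k(Γ, σ_{x_{s-1}} ⋯ σ_{x_1} Λ)` at the vertex `x_s`. -/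
noncomputable def Mof : (Λ : Fin n → Fin n → ℕ) → (S : List (Fin n)) → Rep k n Λ
  | Λ, [] => zeroRep k n Λ
  | Λ, [x] => simpleRep Λ x
  | Λ, x :: y :: ys => reflMinus x Λ (Mof (flipO x Λ) (y :: ys))

variable {n : ℕ}

/-! ## The Weyl group -/

/-- The simple reflection `σ_i` attached to a generalized Cartan matrix `A`,
as a linear endomorphism of `ℤⁿ` : `σ_i(v) = v - (∑ l, a_{il} v_l) e_i`. -/
def sigmaL (A : Fin n → Fin n → ℤ) (i : Fin n) : (Fin n → ℤ) →ₗ[ℤ] (Fin n → ℤ) where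
  toFun v := v - (∑ l, A i l * v l) • Pi.single i 1
  map_add' v w := by
    simp only [Pi.add_apply, mul_add, Finset.sum_add_distrib, add_smul]
    abel
  map_smul' c v := by
    simp only [Pi.smul_apply, smul_eq_mul, RingHom.id_apply, smul_sub]
    congr 1
    rw [smul_smul, Finset.mul_sum]
    congr 1
    exact Finset.sum_congr rfl fun l _ => by ring

theorem sigma_invol (A : Fin n → Fin n → ℤ) (hA : ∀ i, A i i = 2) (i : Fin n) :
    (sigmaL A i).comp (sigmaL A i) = LinearMap.id := by
  apply LinearMap.ext
  intro v
  simp only [LinearMap.comp_apply, LinearMap.id_apply, sigmaL, LinearMap.coe_mk, AddHom.coe_mk]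
  set c := ∑ l, A i l * v l with hc
  set s : Fin n → ℤ := Pi.single i 1 with hs
  have h1 : ∑ l, A i l * (v - c • s) l = -c := by
    have h2 : ∀ l, A i l * (v - c • s) l = A i l * v l - c * (A i l * s l) := fun l => by
      simp only [Pi.sub_apply, Pi.smul_apply, smul_eq_mul]
      ring
    rw [Finset.sum_congr rfl fun l _ => h2 l, Finset.sum_sub_distrib, ← Finset.mul_sum]
    have h3 : ∑ l, A i l * s l = 2 := by
      rw [Finset.sum_eq_single i]
      · simp [hs, hA i]
      · intro b _ hb
        simp [hs, Pi.single_eq_of_ne hb]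
      · simp
    rw [h3, ← hc]
    ring
  rw [h1]
  ext j
  simp only [Pi.sub_apply, Pi.smul_apply, smul_eq_mul]
  ring

/-- The simple reflection `σ_i` as an automorphism of `ℤⁿ`. -/
def sigmaE (A : Fin n → Fin n → ℤ) (hA : ∀ i, A i i = 2) (i : Fin n) :
    (Fin n → ℤ) ≃ₗ[ℤ] (Fin n → ℤ) :=
  LinearEquiv.ofLinear (sigmaL A i) (sigmaL A i) (sigma_invol A hA i) (sigma_invol A hA i)

/-- The length `ℓ(w)`: the least `l ≥ 0` such that `w` is a product of `l` simple
reflections. -/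
noncomputable def wordLen (A : Fin n → Fin n → ℤ) (hA : ∀ i, A i i = 2)
    (w : (Fin n → ℤ) ≃ₗ[ℤ] (Fin n → ℤ)) : ℕ :=
  sInf {l | ∃ ys : List (Fin n), ys.length = l ∧ w = (ys.map (sigmaE A hA)).prod}

/-- The word `w(S) = σ_{x_s} ⋯ σ_{x_1}` associated to a sequence `S = x₁, …, x_s`. -/
def wordOf (A : Fin n → Fin n → ℤ) (hA : ∀ i, A i i = 2) (S : List (Fin n)) :
    (Fin n → ℤ) ≃ₗ[ℤ] (Fin n → ℤ) :=
  ((S.reverse).map (sigmaE A hA)).prod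

/-- The symmetric generalized Cartan matrix of the underlying graph of `(Γ, Λ)`. -/
def cartanOf (Λ : Fin n → Fin n → ℕ) : Fin n → Fin n → ℤ :=
  fun i j => if i = j then 2 else -(edges Λ i j : ℤ)

theorem cartan_diag (Λ : Fin n → Fin n → ℕ) : ∀ i, cartanOf Λ i i = 2 := by
  intro i; simp [cartanOf]

/-- The simple reflections of the Weyl group of the underlying graph of `(Γ, Λ)`. -/
def wSig (Λ : Fin n → Fin n → ℕ) : Fin n → ((Fin n → ℤ) ≃ₗ[ℤ] (Fin n → ℤ)) :=
  sigmaE (cartanOf Λ) (cartan_diag Λ)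

/-- `w(S)` for a sequence of vertices of `(Γ, Λ)`. -/
def wordOfSeq (Λ : Fin n → Fin n → ℕ) (S : List (Fin n)) :
    (Fin n → ℤ) ≃ₗ[ℤ] (Fin n → ℤ) :=
  ((S.reverse).map (wSig Λ)).prod

/-- The word `w(S)` is reduced: `ℓ(w(S))` equals the number of letters of `S`. -/
noncomputable def IsReducedSeq (Λ : Fin n → Fin n → ℕ) (S : List (Fin n)) : Prop :=
  wordLen (cartanOf Λ) (cartan_diag Λ) (wordOfSeq Λ S) = S.length

/-! ## Dynkin graphs of types A, D, E -/

def edgeA (n : ℕ) : Fin n → Fin n → ℕ := fun i j =>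
  if (i : ℕ) + 1 = (j : ℕ) ∨ (j : ℕ) + 1 = (i : ℕ) then 1 else 0

def edgeD (n : ℕ) : Fin n → Fin n → ℕ := fun i j =>
  if ((i : ℕ) = 0 ∧ (j : ℕ) = 2) ∨ ((j : ℕ) = 0 ∧ (i : ℕ) = 2) ∨
     ((i : ℕ) = 1 ∧ (j : ℕ) = 2) ∨ ((j : ℕ) = 1 ∧ (i : ℕ) = 2) ∨
     (2 ≤ (i : ℕ) ∧ (i : ℕ) + 1 = (j : ℕ)) ∨ (2 ≤ (j : ℕ) ∧ (j : ℕ) + 1 = (i : ℕ))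
  then 1 else 0

def edgeE (n : ℕ) : Fin n → Fin n → ℕ := fun i j =>
  if ((i : ℕ) + 1 = (j : ℕ) ∧ (j : ℕ) ≤ n - 2) ∨ ((j : ℕ) + 1 = (i : ℕ) ∧ (i : ℕ) ≤ n - 2) ∨
     ((i : ℕ) = 2 ∧ (j : ℕ) = n - 1) ∨ ((j : ℕ) = 2 ∧ (i : ℕ) = n - 1)
  then 1 else 0

/-- The underlying graph (given by its edge-count function `E`) is a Dynkin diagram of
type `A`, `D`, or `E`. -/
def IsDynkinADE (n : ℕ) (E : Fin n → Fin n → ℕ) : Prop :=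
  ∃ e : Fin n ≃ Fin n,
    (∀ i j, E i j = edgeA n (e i) (e j)) ∨
    (4 ≤ n ∧ ∀ i j, E i j = edgeD n (e i) (e j)) ∨
    ((n = 6 ∨ n = 7 ∨ n = 8) ∧ ∀ i j, E i j = edgeE n (e i) (e j))

/-! ## Coxeter-sortable elements -/

/-- Lexicographic comparison of index tuples. -/
def lexLE {s : ℕ} (ι ι' : Fin s → ℕ) : Prop :=
  ι = ι' ∨ ∃ j, (∀ j', j' < j → ι j' = ι' j') ∧ ι j < ι' j

/-- `w` is `c`-sortable for the Coxeter element determined by the half-infinite word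
`cseq` (with dividers every `blockLen` letters): the lexicographically first subsequence
of `cseq` that is a reduced word for `w` defines a sequence of subsets (between adjacent
dividers) that is decreasing under inclusion. -/
def CSortable (A : Fin n → Fin n → ℤ) (hA : ∀ i, A i i = 2) (cseq : ℕ → Fin n)
    (blockLen : ℕ) (w : (Fin n → ℤ) ≃ₗ[ℤ] (Fin n → ℤ)) : Prop :=
  ∃ (s : ℕ) (ι : Fin s → ℕ), StrictMono ι ∧
    w = ((List.ofFn fun j => cseq (ι j)).map (sigmaE A hA)).prod ∧
    wordLen A hA w = s ∧
    (∀ ι' : Fin s → ℕ, StrictMono ι' →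
      w = ((List.ofFn fun j => cseq (ι' j)).map (sigmaE A hA)).prod → lexLE ι ι') ∧
    ∀ m : ℕ, {a : Fin n | ∃ j, (ι j) / blockLen = m + 1 ∧ cseq (ι j) = a} ⊆
             {a : Fin n | ∃ j, (ι j) / blockLen = m ∧ cseq (ι j) = a}


/-- A nonzero non-isomorphism between representations. -/
def RepStep {k : Type} [Field k] {n : ℕ} {Λ : Fin n → Fin n → ℕ} (X Y : Rep k n Λ) : Prop :=
  ∃ f : RepHom X Y, (∃ x v, f.g x v ≠ 0) ∧ ¬ ∀ x, Function.Bijective (f.g x)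

/-- `v` is a minimal element of `D` in the poset `(Γ₀, Λ)`. -/
def MinimalIn {n : ℕ} (Λ : Fin n → Fin n → ℕ) (D : Set (Fin n)) (v : Fin n) : Prop :=
  v ∈ D ∧ ∀ u ∈ D, PathLE Λ u v → u = v

/-- The pairs `(h, v)` of Proposition 3.2(a): `0 < h ≤ r` and `v` a minimal element of
`Supp S_h \ H_Λ(Supp S_{h+1})` (with `Supp S_{r+1} = ∅`). -/
def JoinPair {n : ℕ} (Λ : Fin n → Fin n → ℕ) (segs : List (List (Fin n)))
    (p : ℕ × Fin n) : Prop :=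
  0 < p.1 ∧ p.1 ≤ segs.length ∧
  MinimalIn Λ (suppOf (segs.getD (p.1 - 1) []) \ hull Λ (suppOf (segs.getD p.1 []))) p.2

section Weyl

/-- The simple root `e_i`. -/
def ee (i : Fin n) : Fin n → ℤ := Pi.single i 1

/-- The pairing with the `i`-th row of the Cartan matrix. -/
def cB (Λ : Fin n → Fin n → ℕ) (i : Fin n) : (Fin n → ℤ) →ₗ[ℤ] ℤ where
  toFun v := ∑ l, cartanOf Λ i l * v l
  map_add' v w := by simp [mul_add, Finset.sum_add_distrib]
  map_smul' c v := by
    simp only [Pi.smul_apply, smul_eq_mul, RingHom.id_apply, Finset.mul_sum]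
    exact Finset.sum_congr rfl fun l _ => by ring

theorem cB_apply (Λ : Fin n → Fin n → ℕ) (i : Fin n) (v : Fin n → ℤ) :
    cB Λ i v = ∑ l, cartanOf Λ i l * v l := rfl

theorem cB_ee (Λ : Fin n → Fin n → ℕ) (i j : Fin n) : cB Λ i (ee j) = cartanOf Λ i j := by
  rw [cB_apply, Finset.sum_eq_single j] <;> simp +contextual [ee]

theorem wSig_apply (Λ : Fin n → Fin n → ℕ) (i : Fin n) (v : Fin n → ℤ) :
    wSig Λ i v = v - cB Λ i v • ee i := rfl

theorem ee_self (i : Fin n) : ee i i = 1 := by simp [ee]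
theorem ee_ne {i j : Fin n} (h : j ≠ i) : ee i j = 0 := by simp [ee, h]
theorem ee_nonneg (i j : Fin n) : 0 ≤ ee i j := by
  by_cases h : j = i
  · subst h; simp [ee_self]
  · simp [ee_ne h]
theorem ee_ne_zero (i : Fin n) : ee i ≠ 0 := fun h => by
  have := congrFun h i; simp [ee_self] at this

theorem wSig_self (Λ : Fin n → Fin n → ℕ) (i : Fin n) : wSig Λ i (ee i) = - ee i := by
  rw [wSig_apply, cB_ee, cartan_diag, two_smul]; abel

theorem wSig_ne (Λ : Fin n → Fin n → ℕ) {i j : Fin n} (h : i ≠ j) :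
    wSig Λ i (ee j) = ee j + (edges Λ i j : ℤ) • ee i := by
  rw [wSig_apply, cB_ee, cartanOf, if_neg h, neg_smul]; abel

theorem wSig_sq (Λ : Fin n → Fin n → ℕ) (i : Fin n) : wSig Λ i * wSig Λ i = 1 := by
  ext1 v
  rw [LinearEquiv.mul_apply, wSig_apply, wSig_apply, map_sub, map_smul, cB_ee, cartan_diag]
  simp only [smul_eq_mul, LinearEquiv.coe_one, id]
  module

theorem wSig_coord (Λ : Fin n → Fin n → ℕ) {i j : Fin n} (h : j ≠ i) (v : Fin n → ℤ) :
    wSig Λ i v j = v j := by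
  simp [wSig_apply, ee_ne h]

theorem edges_comm (Λ : Fin n → Fin n → ℕ) (i j : Fin n) : edges Λ i j = edges Λ j i := by
  simp [edges, add_comm]

theorem cartan_comm (Λ : Fin n → Fin n → ℕ) (i j : Fin n) : cartanOf Λ i j = cartanOf Λ j i := by
  simp [cartanOf, edges_comm Λ i j, eq_comm]

theorem wSig_commute (Λ : Fin n → Fin n → ℕ) {i j : Fin n} (h : edges Λ i j = 0) :
    wSig Λ i * wSig Λ j = wSig Λ j * wSig Λ i := by
  by_cases hij : i = j
  · rw [hij]
  have h1 : cartanOf Λ i j = 0 := by simp [cartanOf, hij, h]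
  have h2 : cartanOf Λ j i = 0 := by rw [cartan_comm, h1]
  ext1 v
  simp only [LinearEquiv.mul_apply, wSig_apply, map_sub, map_smul, cB_ee, h1, h2]
  module

theorem wSig_braid (Λ : Fin n → Fin n → ℕ) {i j : Fin n} (hij : i ≠ j) (h : edges Λ i j = 1) :
    wSig Λ i * wSig Λ j * wSig Λ i = wSig Λ j * wSig Λ i * wSig Λ j := by
  have h1 : cartanOf Λ i j = -1 := by simp [cartanOf, hij, h]
  have h2 : cartanOf Λ j i = -1 := by rw [cartan_comm, h1]
  ext1 v
  simp only [LinearEquiv.mul_apply, wSig_apply, map_sub, map_smul, cB_ee, h1, h2,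
    cartan_diag]
  module

/-- The product of simple reflections along a list. -/
def act (Λ : Fin n → Fin n → ℕ) (q : List (Fin n)) : (Fin n → ℤ) ≃ₗ[ℤ] (Fin n → ℤ) :=
  (q.map (wSig Λ)).prod

@[simp] theorem act_nil (Λ : Fin n → Fin n → ℕ) : act Λ [] = 1 := rfl
@[simp] theorem act_cons (Λ : Fin n → Fin n → ℕ) (a q) :
    act Λ (a :: q) = wSig Λ a * act Λ q := by simp [act]
@[simp] theorem act_append (Λ : Fin n → Fin n → ℕ) (p q) :
    act Λ (p ++ q) = act Λ p * act Λ q := by simp [act]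

theorem act_reverse (Λ : Fin n → Fin n → ℕ) (q) : act Λ q.reverse = (act Λ q)⁻¹ := by
  induction q with
  | nil => simp
  | cons a q ih =>
    have : (wSig Λ a)⁻¹ = wSig Λ a := inv_eq_of_mul_eq_one_left (wSig_sq Λ a)
    simp [ih, mul_inv_rev, this]

theorem det_wSig (Λ : Fin n → Fin n → ℕ) (i : Fin n) : LinearEquiv.det (wSig Λ i) = -1 := by
  apply Units.ext
  rw [LinearEquiv.coe_det]
  have : (wSig Λ i : (Fin n → ℤ) →ₗ[ℤ] (Fin n → ℤ)) = LinearMap.transvection (-(cB Λ i)) (ee i) := by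
    refine LinearMap.ext fun v => ?_
    rw [LinearMap.transvection.apply, LinearEquiv.coe_coe, wSig_apply, LinearMap.neg_apply,
      neg_smul, sub_eq_add_neg]
  rw [this, LinearMap.transvection.det]
  simp [cB_ee, cartan_diag]

theorem det_act (Λ : Fin n → Fin n → ℕ) (q) : LinearEquiv.det (act Λ q) = (-1) ^ q.length := by
  induction q with
  | nil => simp
  | cons a q ih => rw [act_cons, map_mul, ih, det_wSig, List.length_cons, pow_succ']

theorem act_parity (Λ : Fin n → Fin n → ℕ) {p q} (h : act Λ p = act Λ q) :
    p.length % 2 = q.length % 2 := by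
  have h1 : ((-1 : ℤˣ)) ^ p.length = (-1) ^ q.length := by rw [← det_act Λ, ← det_act Λ, h]
  rcases Nat.even_or_odd p.length with hp | hp <;> rcases Nat.even_or_odd q.length with hq | hq
  · rw [Nat.even_iff] at *; omega
  · rw [hp.neg_one_pow, hq.neg_one_pow] at h1; exact absurd h1 (by decide)
  · rw [hp.neg_one_pow, hq.neg_one_pow] at h1; exact absurd h1 (by decide)
  · rw [Nat.odd_iff] at *; omega

/-- A word is reduced. -/
def Red (Λ : Fin n → Fin n → ℕ) (q : List (Fin n)) : Prop :=
  ∀ z, act Λ z = act Λ q → q.length ≤ z.length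

theorem Red.infix {Λ : Fin n → Fin n → ℕ} {p q r : List (Fin n)} (h : Red Λ (p ++ q ++ r)) :
    Red Λ q := by
  intro z hz
  have := h (p ++ z ++ r) (by simp [hz])
  simp at this; omega

theorem Red.left {Λ : Fin n → Fin n → ℕ} {p q : List (Fin n)} (h : Red Λ (p ++ q)) :
    Red Λ p := Red.infix (p := []) (r := q) (by simpa using h)

theorem Red.right {Λ : Fin n → Fin n → ℕ} {p q : List (Fin n)} (h : Red Λ (p ++ q)) :
    Red Λ q := Red.infix (p := p) (r := []) (by simpa using h)

theorem Red.of_eq {Λ : Fin n → Fin n → ℕ} {p q : List (Fin n)} (h : Red Λ q)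
    (h1 : act Λ p = act Λ q) (h2 : p.length = q.length) : Red Λ p := by
  intro z hz
  rw [h2]; exact h z (hz.trans h1)

theorem exists_red (Λ : Fin n → Fin n → ℕ) (q : List (Fin n)) :
    ∃ p, act Λ p = act Λ q ∧ Red Λ p := by
  classical
  have hex : ∃ m, ∃ p, act Λ p = act Λ q ∧ p.length = m := ⟨_, q, rfl, rfl⟩
  obtain ⟨p, hp, hl⟩ := Nat.find_spec hex
  refine ⟨p, hp, fun z hz => ?_⟩
  rw [hl]
  exact Nat.find_min' hex ⟨z, hz.trans hp, rfl⟩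

theorem Red.shorten {Λ : Fin n → Fin n → ℕ} {q : List (Fin n)} {s : Fin n} (h : Red Λ q)
    (h' : ¬ Red Λ (q ++ [s])) :
    ∃ p, act Λ p = act Λ (q ++ [s]) ∧ p.length + 1 = q.length := by
  simp only [Red, not_forall, not_le] at h'
  obtain ⟨z, hz, hl⟩ := h'
  refine ⟨z, hz, ?_⟩
  have h1 := act_parity Λ hz
  have h2 := h (z ++ [s]) (by simp [hz, mul_assoc, wSig_sq])
  simp at h1 h2 hl
  omega

theorem not_red_dup {Λ : Fin n → Fin n → ℕ} {p q : List (Fin n)} {a : Fin n} :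
    ¬ Red Λ (p ++ a :: a :: q) := by
  intro h
  have := h (p ++ q) (by simp [← mul_assoc (wSig Λ a) (wSig Λ a), wSig_sq])
  simp at this

/-- Rank two computation with at least two edges. -/
theorem dihedral_aux {Λ : Fin n → Fin n → ℕ} {s t : Fin n} (hst : s ≠ t)
    (ha : 2 ≤ edges Λ s t) : ∀ r : List (Fin n), (∀ y ∈ r, y = s ∨ y = t) → Red Λ (r ++ [s]) →
    ∃ c d : ℤ, 0 ≤ c ∧ 0 ≤ d ∧ act Λ r (ee s) = c • ee s + d • ee t ∧
      ((r ++ [s]).head? = some s → d ≤ c) ∧ ((r ++ [s]).head? = some t → c ≤ d)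
  | [], _, _ => ⟨1, 0, by simp, by simp, by simp, by simp, by simp [hst]⟩
  | y :: r, hy, hred => by
    obtain ⟨c, d, hc, hd, he, h1, h2⟩ := dihedral_aux hst ha r (fun z hz => hy z (by simp [hz]))
      (Red.right (p := [y]) (by simpa using hred))
    have ha' : (2 : ℤ) ≤ edges Λ s t := by exact_mod_cast ha
    have hne : (r ++ [s]).head? ≠ some y := by
      intro hh
      cases r with
      | nil =>
        simp at hh; subst hh
        exact not_red_dup (p := []) (q := []) (by simpa using hred)
      | cons z r =>
        simp at hh; subst hh
        exact not_red_dup (p := []) (q := r ++ [s]) (by simpa using hred)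
    have hor : (r ++ [s]).head? = some s ∨ (r ++ [s]).head? = some t := by
      cases r with
      | nil => simp
      | cons z r => simpa using hy z (by simp)
    rcases hy y (by simp) with rfl | rfl
    · have hh := hor.resolve_left hne
      refine ⟨edges Λ y t * d - c, d, ?_, hd, ?_, ?_, by simp [hst]⟩
      · nlinarith [h2 hh]
      · simp only [act_cons, LinearEquiv.mul_apply, he, map_add, map_smul, wSig_self, wSig_ne Λ hst]
        module
      · intro _; nlinarith [h2 hh]
    · have hh := hor.resolve_right hne
      refine ⟨c, edges Λ s y * c - d, hc, ?_, ?_, by simp [hst.symm], ?_⟩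
      · nlinarith [h1 hh]
      · simp only [act_cons, LinearEquiv.mul_apply, he, map_add, map_smul, wSig_self,
          wSig_ne Λ hst.symm, edges_comm Λ y s]
        module
      · intro _; nlinarith [h1 hh]

theorem dihedral {Λ : Fin n → Fin n → ℕ} {s t : Fin n} (hst : s ≠ t)
    (r : List (Fin n)) (hr : ∀ y ∈ r, y = s ∨ y = t) (hred : Red Λ (r ++ [s])) :
    ∃ c d : ℤ, 0 ≤ c ∧ 0 ≤ d ∧ act Λ r (ee s) = c • ee s + d • ee t := by
  by_cases ha : 2 ≤ edges Λ s t
  · obtain ⟨c, d, hc, hd, h, -⟩ := dihedral_aux hst ha r hr hred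
    exact ⟨c, d, hc, hd, h⟩
  rcases List.eq_nil_or_concat r with rfl | ⟨r, y, rfl⟩
  · exact ⟨1, 0, by simp, by simp, by simp⟩
  have hy : y = t := by
    rcases hr y (by simp) with rfl | h
    · exact absurd hred (by simpa using not_red_dup (p := r) (q := []))
    · exact h
  subst hy
  have hts : edges Λ y s = edges Λ s y := edges_comm Λ y s
  rcases List.eq_nil_or_concat r with rfl | ⟨r, z, rfl⟩
  · refine ⟨1, edges Λ s y, by simp, by simp, ?_⟩
    simp [wSig_ne Λ hst.symm, hts]
  have hz : z = s := by
    rcases hr z (by simp) with h | rfl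
    · exact h
    · exact absurd hred (by simpa using not_red_dup (p := r) (q := [s]))
  subst hz
  have ha0 : edges Λ z y ≠ 0 := by
    intro h0
    have := hred (r ++ [y]) (by
      simp only [List.append_assoc, List.concat_eq_append, act_append, act_cons, act_nil, mul_one]
      rw [wSig_commute Λ (hts.trans h0), ← mul_assoc (wSig Λ z), wSig_sq, one_mul])
    simp at this
  have ha1 : edges Λ z y = 1 := by omega
  have hts1 : edges Λ y z = 1 := by omega
  rcases List.eq_nil_or_concat r with rfl | ⟨r, w, rfl⟩
  · refine ⟨0, 1, by simp, by simp, ?_⟩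
    simp [wSig_ne Λ hst.symm, wSig_ne Λ hst, wSig_self, hts1, ha1]
  have hw : w = y := by
    rcases hr w (by simp) with rfl | h
    · exact absurd hred (by simpa using not_red_dup (p := r) (q := [y, w]))
    · exact h
  subst hw
  exfalso
  have := hred (r ++ [z, w]) (by
    have hb := wSig_braid Λ hst ha1
    simp only [List.append_assoc, List.concat_eq_append, act_append, act_cons, act_nil, mul_one]
    congr 1
    rw [← mul_assoc (wSig Λ z), hb]
    simp only [← mul_assoc]
    simp [wSig_sq])
  simp at this

theorem pos_of_red (Λ : Fin n → Fin n → ℕ) : ∀ (N : ℕ) (q : List (Fin n)) (s : Fin n),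
    q.length = N → Red Λ (q ++ [s]) → ∀ j, 0 ≤ act Λ q (ee s) j := by
  classical
  intro N
  induction N using Nat.strong_induction_on with
  | _ N ih =>
  intro q s hN hred j
  rcases List.eq_nil_or_concat q with rfl | ⟨q', t, rfl⟩
  · simpa using ee_nonneg s j
  have hst : s ≠ t := by
    rintro rfl
    exact absurd hred (by simpa using not_red_dup (p := q') (q := []))
  set q := q'.concat t with hq
  have hex : ∃ m, ∃ p r : List (Fin n), p.length = m ∧ p.length + r.length = N ∧
      act Λ (p ++ r) = act Λ q ∧ (∀ y ∈ r, y = s ∨ y = t) ∧ r ≠ [] :=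
    ⟨_, q', [t], rfl, by rw [← hN]; simp [hq], by simp [hq], by simp, by simp⟩
  obtain ⟨p, r, hpm, hlen, hact, hr, hr0⟩ := Nat.find_spec hex
  have hmin := fun m => Nat.find_min' hex (m := m)
  rw [← hpm] at hmin
  have hred2 : Red Λ (p ++ (r ++ [s])) := by
    refine Red.of_eq hred ?_ ?_
    · rw [← List.append_assoc, act_append, hact, ← act_append]
    · simp; omega
  have hrl : 0 < r.length := List.length_pos_iff.2 hr0
  have key : ∀ y, (y = s ∨ y = t) → ∀ j, 0 ≤ act Λ p (ee y) j := by
    intro y hy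
    apply ih p.length (by omega) p y rfl
    by_contra hcon
    obtain ⟨p', hp', hl⟩ := Red.shorten (Red.left hred2) hcon
    have := hmin p'.length ⟨p', y :: r, rfl, by simp; omega, by
      rw [← hact]; simp [hp', ← mul_assoc, mul_assoc _ (wSig Λ y) (wSig Λ y), wSig_sq], by
      intro z hz
      rcases List.mem_cons.1 hz with rfl | hz
      · exact hy
      · exact hr z hz, by simp⟩
    omega
  obtain ⟨c, d, hc, hd, he⟩ := dihedral hst r hr (Red.right hred2)
  rw [← hact, act_append, LinearEquiv.mul_apply, he]
  simp only [map_add, map_smul, Pi.add_apply, Pi.smul_apply, smul_eq_mul]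
  have h1 := key s (Or.inl rfl) j
  have h2 := key t (Or.inr rfl) j
  positivity

theorem neg_of_not_red (Λ : Fin n → Fin n → ℕ) {q : List (Fin n)} {s : Fin n} (h : Red Λ q)
    (h' : ¬ Red Λ (q ++ [s])) (j : Fin n) : act Λ q (ee s) j ≤ 0 := by
  obtain ⟨p, hp, hl⟩ := Red.shorten h h'
  have hq : act Λ (p ++ [s]) = act Λ q := by simp [hp, mul_assoc, wSig_sq]
  have h2 : Red Λ (p ++ [s]) := Red.of_eq h hq (by simpa using hl)
  have h3 := pos_of_red Λ _ p s rfl h2 j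
  rw [← hq, act_append, LinearEquiv.mul_apply]
  simp only [act_cons, act_nil, mul_one, wSig_self, map_neg, Pi.neg_apply]
  omega

theorem sign_coherent (Λ : Fin n → Fin n → ℕ) (q : List (Fin n)) (s : Fin n) :
    (∀ j, 0 ≤ act Λ q (ee s) j) ∨ (∀ j, act Λ q (ee s) j ≤ 0) := by
  obtain ⟨p, hp, hred⟩ := exists_red Λ q
  rw [← hp]
  by_cases h : Red Λ (p ++ [s])
  · exact Or.inl (pos_of_red Λ _ p s rfl h)
  · exact Or.inr (neg_of_not_red Λ hred h)

theorem act_ee_ne (Λ : Fin n → Fin n → ℕ) (q : List (Fin n)) (s : Fin n) :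
    act Λ q (ee s) ≠ 0 := by
  intro h
  exact ee_ne_zero s ((act Λ q).map_eq_zero_iff.1 h)

/-- All roots of the word are positive. -/
def PosL (Λ : Fin n → Fin n → ℕ) (q : List (Fin n)) : Prop :=
  ∀ A y B, q = A ++ y :: B → ∀ j, 0 ≤ act Λ A (ee y) j

theorem red_of_posL (Λ : Fin n → Fin n → ℕ) (q : List (Fin n)) (h : PosL Λ q) : Red Λ q := by
  induction q using List.reverseRecOn with
  | nil => intro z _; simp
  | append_singleton q s ih =>
    have hq : Red Λ q := ih fun A y B hAB => h A y (B ++ [s]) (by simp [hAB])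
    by_contra hcon
    refine act_ee_ne Λ q s ?_
    ext j
    exact le_antisymm (neg_of_not_red Λ hq hcon j) (h q s [] rfl j)

theorem red_iff_posL (Λ : Fin n → Fin n → ℕ) (q : List (Fin n)) : Red Λ q ↔ PosL Λ q := by
  refine ⟨fun h A y B hq => ?_, red_of_posL Λ q⟩
  subst hq
  exact pos_of_red Λ _ A y rfl (Red.left (q := B) (by simpa using h))

theorem Red.reverse {Λ : Fin n → Fin n → ℕ} {q : List (Fin n)} (h : Red Λ q) :
    Red Λ q.reverse := by
  intro z hz
  have := h z.reverse (by rw [act_reverse, hz, act_reverse, inv_inv])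
  simpa using this

theorem isReducedSeq_iff (Λ : Fin n → Fin n → ℕ) (S : List (Fin n)) :
    IsReducedSeq Λ S ↔ Red Λ S := by
  have hiff : Red Λ S ↔ Red Λ S.reverse := ⟨Red.reverse, fun h => by simpa using h.reverse⟩
  rw [hiff]
  unfold IsReducedSeq wordLen
  set X := {l | ∃ ys : List (Fin n), ys.length = l ∧
    wordOfSeq Λ S = (ys.map (sigmaE (cartanOf Λ) (cartan_diag Λ))).prod} with hX
  have hmem : S.length ∈ X := ⟨S.reverse, by simp, rfl⟩
  constructor
  · intro h z hz
    rw [List.length_reverse, ← h]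
    exact Nat.sInf_le ⟨z, rfl, hz.symm⟩
  · intro h
    apply le_antisymm (Nat.sInf_le hmem)
    obtain ⟨ys, hl, hy⟩ := Nat.sInf_mem ⟨_, hmem⟩
    rw [← hl]
    simpa using h ys hy.symm

end Weyl

section Comb

theorem edges_flip (x : Fin n) (Λ : Fin n → Fin n → ℕ) : edges (flipO x Λ) = edges Λ := by
  funext a b
  by_cases h : a = x ∨ b = x
  · simp [edges, flipO, h, h.symm, add_comm]
  · have h' : ¬ (b = x ∨ a = x) := fun h2 => h h2.symm
    simp [edges, flipO, h, h']

theorem cartan_flip (x : Fin n) (Λ : Fin n → Fin n → ℕ) : cartanOf (flipO x Λ) = cartanOf Λ := by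
  funext i j; simp [cartanOf, edges_flip]

theorem wSig_flip (x : Fin n) (Λ : Fin n → Fin n → ℕ) : wSig (flipO x Λ) = wSig Λ := by
  funext i
  ext1 v
  simp [wSig_apply, cB_apply, cartan_flip]

theorem act_flip (x : Fin n) (Λ : Fin n → Fin n → ℕ) : act (flipO x Λ) = act Λ := by
  funext q
  simp [act, wSig_flip]

theorem act_coord (Λ : Fin n → Fin n → ℕ) {m : Fin n} {D : List (Fin n)} (h : m ∉ D)
    (v : Fin n → ℤ) : act Λ D v m = v m := by
  induction D with
  | nil => simp
  | cons a D ih =>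
    simp only [List.mem_cons, not_or] at h
    rw [act_cons, LinearEquiv.mul_apply, wSig_coord Λ h.1, ih h.2]

theorem Admissible.right {Λ : Fin n → Fin n → ℕ} {A B : List (Fin n)}
    (h : Admissible Λ (A ++ B)) : Admissible (orientAfter Λ A) B := by
  induction A generalizing Λ with
  | nil => exact h
  | cons a A ih => exact ih h.2

theorem Admissible.left {Λ : Fin n → Fin n → ℕ} {A B : List (Fin n)}
    (h : Admissible Λ (A ++ B)) : Admissible Λ A := by
  induction A generalizing Λ with
  | nil => trivial
  | cons a A ih => exact ⟨h.1, ih h.2⟩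

theorem orientAfter_append (Λ : Fin n → Fin n → ℕ) (A B : List (Fin n)) :
    orientAfter Λ (A ++ B) = orientAfter (orientAfter Λ A) B := by
  induction A generalizing Λ with
  | nil => rfl
  | cons a A ih => exact ih _

theorem edges_orientAfter (Λ : Fin n → Fin n → ℕ) (A : List (Fin n)) :
    edges (orientAfter Λ A) = edges Λ := by
  induction A generalizing Λ with
  | nil => rfl
  | cons a A ih => exact (ih _).trans (edges_flip a Λ)

theorem not_mem_of_adm {Λ : Fin n → Fin n → ℕ} {a c : Fin n} (h : Λ a c ≠ 0) {T : List (Fin n)}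
    (hT : Admissible Λ T) (hc : c ∉ T) : a ∉ T := by
  induction T generalizing Λ with
  | nil => simp
  | cons x T ih =>
    simp only [List.mem_cons, not_or] at hc ⊢
    have hax : a ≠ x := by
      rintro rfl
      exact h (hT.1 c)
    refine ⟨hax, ih ?_ hT.2 hc.2⟩
    simpa [flipO, hax, hc.1] using h

theorem orient_parity (Λ : Fin n → Fin n → ℕ) {a c : Fin n} (hac : a ≠ c) (T : List (Fin n)) :
    orientAfter Λ T a c = if Even (T.count a + T.count c) then Λ a c else Λ c a := by
  induction T generalizing Λ with
  | nil => simp [orientAfter]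
  | cons x T ih =>
    rw [orientAfter, ih]
    by_cases hxa : x = a
    · subst hxa
      have : ∀ m, Even (T.count x + 1 + m) ↔ ¬ Even (T.count x + m) := by
        intro m; rw [show T.count x + 1 + m = (T.count x + m) + 1 by ring, Nat.even_add_one]
      simp [flipO, hac, this]
      by_cases h : Even (T.count x + T.count c) <;> simp [h]
    · by_cases hxc : x = c
      · subst hxc
        have : ∀ m, Even (m + (T.count x + 1)) ↔ ¬ Even (m + T.count x) := by
          intro m; rw [← add_assoc, Nat.even_add_one]
        simp [flipO, hxa, this]
        by_cases h : Even (T.count a + T.count x) <;> simp [h]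
      · simp [flipO, hxa, hxc, Ne.symm hxa, Ne.symm hxc]

/-- Every letter but the last one is followed by an adjacent letter. -/
def Qr (Λ : Fin n → Fin n → ℕ) : List (Fin n) → Prop
  | [] => True
  | a :: B => (B ≠ [] → ∃ b ∈ B, edges Λ a b ≠ 0) ∧ Qr Λ B

theorem Qr.right {Λ : Fin n → Fin n → ℕ} {A B : List (Fin n)} (h : Qr Λ (A ++ B)) : Qr Λ B := by
  induction A with
  | nil => exact h
  | cons a A ih => exact ih h.2

theorem Qr_of (Λ : Fin n → Fin n → ℕ) (T : List (Fin n))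
    (h : ∀ A a B, T = A ++ a :: B → B ≠ [] → ∃ b ∈ B, edges Λ a b ≠ 0) : Qr Λ T := by
  induction T with
  | nil => trivial
  | cons x T ih =>
    exact ⟨h [] x T rfl, ih fun A a B hAB => h (x :: A) a B (by simp [hAB])⟩

theorem Qr.swap {Λ : Fin n → Fin n → ℕ} {T T' : List (Fin n)} (hs : SwapRel (edges Λ) T T')
    (h : Qr Λ T) : Qr Λ T' := by
  obtain ⟨l₁, l₂, a, b, hab⟩ := hs
  induction l₁ with
  | nil =>
    obtain ⟨h1, h2, h3⟩ := h
    obtain ⟨c, hc, hac⟩ := h1 (by simp)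
    have hc2 : c ∈ l₂ := by
      rcases List.mem_cons.1 hc with rfl | hc
      · exact absurd hab hac
      · exact hc
    refine ⟨fun _ => ?_, fun _ => ⟨c, hc2, hac⟩, h3⟩
    obtain ⟨d, hd, hbd⟩ := h2 (List.ne_nil_of_mem hc2)
    exact ⟨d, by simp [hd], hbd⟩
  | cons x l₁ ih =>
    refine ⟨fun _ => ?_, ih h.2⟩
    obtain ⟨c, hc, hxc⟩ := h.1 (by simp)
    refine ⟨c, ?_, hxc⟩
    simp at hc ⊢
    tauto

theorem Qr.swap_last {Λ : Fin n → Fin n → ℕ} {T T' : List (Fin n)}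
    (hs : SwapRel (edges Λ) T T') (h : Qr Λ T) : T.getLast? = T'.getLast? := by
  obtain ⟨l₁, l₂, a, b, hab⟩ := hs
  have h2 := Qr.right h
  obtain ⟨c, hc, hac⟩ := h2.1 (by simp)
  have hc2 : c ∈ l₂ := by
    rcases List.mem_cons.1 hc with rfl | hc
    · exact absurd hab hac
    · exact hc
  cases l₂ with
  | nil => simp at hc2
  | cons d l => simp [List.getLast?_append, List.getLast?_cons_cons]

theorem SwapRel.symm' {Λ : Fin n → Fin n → ℕ} {T T' : List (Fin n)}
    (hs : SwapRel (edges Λ) T T') : SwapRel (edges Λ) T' T := by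
  obtain ⟨l₁, l₂, a, b, hab⟩ := hs
  exact .swap l₁ l₂ b a (by rw [edges_comm, hab])

theorem Sim.symm' {Λ : Fin n → Fin n → ℕ} {T T' : List (Fin n)}
    (hs : Sim (edges Λ) T T') : Sim (edges Λ) T' T := by
  induction hs with
  | refl => exact .refl
  | tail _ h ih => exact .head h.symm' ih

theorem Qr.sim {Λ : Fin n → Fin n → ℕ} {T T' : List (Fin n)} (hs : Sim (edges Λ) T T')
    (h : Qr Λ T) : Qr Λ T' ∧ T.getLast? = T'.getLast? := by
  induction hs with
  | refl => exact ⟨h, rfl⟩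
  | tail _ hst ih => exact ⟨ih.1.swap hst, ih.2.trans (ih.1.swap_last hst)⟩

theorem Sim.length_eq {Λ : Fin n → Fin n → ℕ} {T T' : List (Fin n)}
    (hs : Sim (edges Λ) T T') : T.length = T'.length := by
  induction hs with
  | refl => rfl
  | tail _ h ih => rw [ih]; obtain ⟨l₁, l₂, a, b, hab⟩ := h; simp

theorem Sim.act_eq {Λ : Fin n → Fin n → ℕ} {T T' : List (Fin n)}
    (hs : Sim (edges Λ) T T') : act Λ T = act Λ T' := by
  induction hs with
  | refl => rfl
  | tail _ h ih =>
    rw [ih]; obtain ⟨l₁, l₂, a, b, hab⟩ := h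
    simp only [act_append, act_cons]
    rw [← mul_assoc (wSig Λ a), wSig_commute Λ hab, mul_assoc]

theorem flatten_split {α : Type*} (segs : List (List α)) : ∀ (A : List α) (a : α) (B : List α),
    segs.flatten = A ++ a :: B → ∃ P seg R A' B', segs = P ++ seg :: R ∧ seg = A' ++ a :: B' ∧
      A = P.flatten ++ A' ∧ B = B' ++ R.flatten := by
  induction segs with
  | nil => intro A a B h; simp at h
  | cons s segs ih =>
    intro A a B h
    rw [List.flatten_cons, List.append_eq_append_iff] at h
    rcases h with ⟨A', hA, h⟩ | ⟨C, hs, h⟩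
    · obtain ⟨P, seg, R, A'', B', h1, h2, h3, h4⟩ := ih A' a B h
      exact ⟨s :: P, seg, R, A'', B', by simp [h1], h2, by simp [hA, h3], h4⟩
    · cases C with
      | nil =>
        obtain ⟨P, seg, R, A'', B', h1, h2, h3, h4⟩ := ih [] a B (by simpa using h.symm)
        refine ⟨s :: P, seg, R, A'', B', by simp [h1], h2, ?_, h4⟩
        simp only [List.append_nil] at hs
        rw [List.flatten_cons, List.append_assoc, ← h3, hs, List.append_nil]
      | cons c C =>
        simp only [List.cons_append, List.cons.injEq] at h
        obtain ⟨rfl, h⟩ := h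
        exact ⟨[], s, segs, A, C, rfl, hs, by simp, h⟩

theorem Qr_principal (Λ : Fin n → Fin n → ℕ) (hn : 2 ≤ n)
    (hloop : ∀ a, Λ a a = 0)
    (hconn : ∀ a b : Fin n, Relation.ReflTransGen (fun u v => edges Λ u v ≠ 0) a b)
    (S : List (Fin n)) (hprin : IsPrincipal Λ S) : Qr Λ S := by
  obtain ⟨r, x, segs, ⟨hadm, hsim, hnd, hsupp⟩, hlen, hr, hhull, hlast⟩ := hprin
  refine (Qr.sim hsim.symm' ?_).1
  -- parity consequence: an arrow `c → a` forces `c` after `a` inside a segment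
  have key : ∀ P seg R A' a B' c, segs = P ++ seg :: R → seg = A' ++ a :: B' → Λ c a ≠ 0 →
      c ∈ seg → c ∈ B' := by
    intro P seg R A' a B' c h1 h2 hca hc
    have hne : a ≠ c := by rintro rfl; exact hca (hloop a)
    have hseg := (hnd seg (by simp [h1])).2
    by_contra hcB
    have hcA : c ∈ A' := by
      rw [h2] at hc; simp [hne.symm, hcB] at hc; exact hc
    have hA := Admissible.right (A := P.flatten ++ A') (B := a :: B' ++ R.flatten)
      (by rw [h1, h2] at hadm; simpa using hadm)
    have hs := hA.1 c
    have hcount : ∀ y ∈ seg, P.flatten.count y = P.length := by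
      intro y hy
      rw [List.count_flatten]
      have : ∀ p ∈ P, p.count y = 1 := by
        intro p hp
        obtain ⟨P1, P2, rfl⟩ := List.append_of_mem hp
        have h3 := hsupp P1.length (by simp [h1])
        have hmem : y ∈ suppOf (segs.getD P1.length []) := by
          rw [h3]
          show y ∈ (segs.drop P1.length).flatten
          simp [h1, hy]
        have hp' : segs.getD P1.length [] = p := by simp [h1]
        rw [hp'] at hmem
        exact List.count_eq_one_of_mem (hnd p (by simp [h1])).2 hmem
      rw [List.map_congr_left (g := fun _ => 1) this]
      simp
    rw [orient_parity Λ hne] at hs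
    have ha : a ∈ seg := by simp [h2]
    have hnd2 := hseg
    rw [h2, List.nodup_append] at hnd2
    have haA : A'.count a = 0 := by
      rw [List.count_eq_zero]
      intro haA
      exact hnd2.2.2 a haA a (by simp) rfl
    have hcA1 : A'.count c = 1 := List.count_eq_one_of_mem hnd2.1 hcA
    rw [List.count_append, List.count_append, hcount a ha, hcount c hc, haA, hcA1] at hs
    rw [if_neg] at hs
    · exact hca hs
    · rw [Nat.not_even_iff]; omega
  apply Qr_of
  intro A a B hAB hB
  obtain ⟨P, seg, R, A', B', h1, h2, h3, h4⟩ := flatten_split segs A a B hAB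
  have hgetP : segs.getD P.length [] = seg := by simp [h1]
  have hamem : a ∈ seg := by simp [h2]
  have edge_of : ∀ c, Λ c a ≠ 0 → edges Λ a c ≠ 0 := by
    intro c h; simp [edges, h]
  cases R with
  | nil =>
    have hrP : r - 1 = P.length := by rw [← hlen, h1]; simp
    rw [hrP, hgetP] at hlast
    have hB' : B = B' := by simpa using h4
    have hmem : ∀ y, y ∈ seg ↔ PathLE Λ x y := fun y => by
      have : y ∈ suppOf seg ↔ y ∈ upSet Λ x := by rw [hlast]
      exact this
    rcases Relation.ReflTransGen.cases_tail ((hmem a).1 hamem) with hax | ⟨c, hc, hca⟩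
    · exfalso
      subst hax
      rcases List.eq_nil_or_concat B' with rfl | ⟨B'', b, rfl⟩
      · exact hB hB'
      have hbmem : b ∈ seg := by simp [h2]
      rcases Relation.ReflTransGen.cases_tail ((hmem b).1 hbmem) with hba | ⟨c, hc, hcb⟩
      · have := (hnd seg (by simp [h1])).2
        rw [h2, List.nodup_append, List.nodup_cons] at this
        exact this.2.1.1 (by simp [hba])
      · have := key P seg [] (A' ++ a :: B'') b [] c h1 (by simp [h2]) hcb ((hmem c).2 hc)
        simp at this
    · exact ⟨c, hB' ▸ key P seg [] A' a B' c h1 h2 hca ((hmem c).2 hc), edge_of c hca⟩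
  | cons seg2 R =>
    have hget2 : segs.getD (P.length + 1) [] = seg2 := by simp [h1]
    have hh := hhull P.length (by rw [← hlen, h1]; simp)
    rw [hgetP, hget2] at hh
    have hmem : ∀ y, y ∈ seg ↔ y ∈ hull Λ (suppOf seg2) := fun y => by
      rw [← hh]; rfl
    obtain ⟨x0, hx0, hpath⟩ := (hmem a).1 hamem
    rcases Relation.ReflTransGen.cases_tail hpath with hax | ⟨c, hc, hca⟩
    · subst hax
      rcases hx0 with hx0 | ⟨z, hz, hze⟩
      · -- `a` occurs again
        have : ∃ c, edges Λ a c ≠ 0 := by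
          have : Nontrivial (Fin n) := Fin.nontrivial_iff_two_le.2 hn
          obtain ⟨b, hb⟩ := exists_ne a
          rcases Relation.ReflTransGen.cases_head (hconn a b) with h | ⟨c, hc, -⟩
          · exact absurd h.symm hb
          · exact ⟨c, hc⟩
        obtain ⟨c, hc⟩ := this
        refine ⟨c, ?_, hc⟩
        by_contra hcB
        have hA := Admissible.right (A := A) (B := a :: B) (by rw [← hAB]; exact hadm)
        have hac : a ≠ c := by rintro rfl; simp [edges, hloop] at hc
        refine not_mem_of_adm (a := a) (c := c) ?_ hA.2 hcB ?_
        · have h5 := hA.1 c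
          have h6 : edges (orientAfter Λ A) a c ≠ 0 := by rw [edges_orientAfter]; exact hc
          simp only [edges, h5, zero_add] at h6
          simpa [flipO] using h6
        · rw [h4]
          have : a ∈ seg2 := hx0
          simp [this]
      · refine ⟨z, ?_, by rw [edges_comm]; exact hze⟩
        have : z ∈ seg2 := hz
        rw [h4]; simp [this]
    · refine ⟨c, ?_, edge_of c hca⟩
      have := key P seg (seg2 :: R) A' a B' c h1 h2 hca ((hmem c).2 ⟨x0, hx0, hc⟩)
      rw [h4]; simp [this]

/-- The Euler form. -/
def eul (Λ : Fin n → Fin n → ℕ) (u v : Fin n → ℤ) : ℤ :=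
  ∑ a, u a * v a - ∑ a, ∑ b, (Λ a b : ℤ) * u a * v b

theorem sink_reflect {Λ : Fin n → Fin n → ℕ} {x : Fin n} (hx : IsSink Λ x) (v : Fin n → ℤ) :
    wSig Λ x v x = (∑ b, (Λ b x : ℤ) * v b) - v x := by
  rw [wSig_apply]
  simp only [Pi.sub_apply, Pi.smul_apply, ee_self, smul_eq_mul, mul_one, cB_apply]
  have : ∀ l, cartanOf Λ x l * v l = (if x = l then 2 * v l else 0) - (Λ l x : ℤ) * v l := by
    intro l
    by_cases h : x = l
    · subst h; simp [cartanOf, hx x]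
    · simp [cartanOf, h, edges, hx l]
  rw [Finset.sum_congr rfl fun l _ => this l, Finset.sum_sub_distrib]
  simp
  ring

theorem eul_sink {Λ : Fin n → Fin n → ℕ} {x : Fin n} (hx : IsSink Λ x) (u v : Fin n → ℤ) :
    eul Λ u v = (∑ a ∈ Finset.univ.erase x, u a * v a -
      ∑ a ∈ Finset.univ.erase x, ∑ b ∈ Finset.univ.erase x, (Λ a b : ℤ) * u a * v b) +
      u x * v x - (∑ a, (Λ a x : ℤ) * u a) * v x := by
  unfold eul
  rw [← Finset.add_sum_erase Finset.univ (fun a => u a * v a) (Finset.mem_univ x),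
    ← Finset.add_sum_erase Finset.univ (fun a => ∑ b, (Λ a b : ℤ) * u a * v b) (Finset.mem_univ x),
    ← Finset.add_sum_erase Finset.univ (fun a => (Λ a x : ℤ) * u a) (Finset.mem_univ x)]
  have h1 : ∀ a, ∑ b, (Λ a b : ℤ) * u a * v b = (Λ a x : ℤ) * u a * v x +
      ∑ b ∈ Finset.univ.erase x, (Λ a b : ℤ) * u a * v b := fun a =>
    (Finset.add_sum_erase Finset.univ (fun b => (Λ a b : ℤ) * u a * v b) (Finset.mem_univ x)).symm
  simp only [h1, Finset.sum_add_distrib, hx _, add_mul, Finset.sum_mul]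
  simp
  ring

theorem eul_source {Λ : Fin n → Fin n → ℕ} {x : Fin n} (hx : IsSink Λ x) (u v : Fin n → ℤ) :
    eul (flipO x Λ) u v = (∑ a ∈ Finset.univ.erase x, u a * v a -
      ∑ a ∈ Finset.univ.erase x, ∑ b ∈ Finset.univ.erase x, (Λ a b : ℤ) * u a * v b) +
      u x * v x - u x * (∑ a, (Λ a x : ℤ) * v a) := by
  unfold eul
  rw [← Finset.add_sum_erase Finset.univ (fun a => u a * v a) (Finset.mem_univ x),
    ← Finset.add_sum_erase Finset.univ (fun a => ∑ b, (flipO x Λ a b : ℤ) * u a * v b)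
      (Finset.mem_univ x)]
  have h1 : ∀ a ∈ Finset.univ.erase x, ∑ b, (flipO x Λ a b : ℤ) * u a * v b =
      ∑ b ∈ Finset.univ.erase x, (Λ a b : ℤ) * u a * v b := by
    intro a ha
    rw [← Finset.add_sum_erase Finset.univ (fun b => (flipO x Λ a b : ℤ) * u a * v b)
      (Finset.mem_univ x)]
    simp only [flipO, or_true, if_true, hx a]
    simp only [Nat.cast_zero, zero_mul, zero_add]
    refine Finset.sum_congr rfl fun b hb => ?_
    simp only [Finset.mem_erase] at ha hb
    simp [ha.1, hb.1]
  rw [Finset.sum_congr rfl h1]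
  have h2 : ∑ b, (flipO x Λ x b : ℤ) * u x * v b = u x * (∑ a, (Λ a x : ℤ) * v a) := by
    rw [Finset.mul_sum]
    refine Finset.sum_congr rfl fun b _ => ?_
    simp [flipO]; ring
  rw [h2]; ring

theorem eul_flip {Λ : Fin n → Fin n → ℕ} {x : Fin n} (hx : IsSink Λ x) (u v : Fin n → ℤ) :
    eul (flipO x Λ) (wSig Λ x u) (wSig Λ x v) = eul Λ u v := by
  rw [eul_source hx, eul_sink hx, sink_reflect hx, sink_reflect hx]
  have h0 : ∀ w : Fin n → ℤ, ∑ a, (Λ a x : ℤ) * wSig Λ x w a = ∑ a, (Λ a x : ℤ) * w a := by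
    intro w
    refine Finset.sum_congr rfl fun a _ => ?_
    by_cases h : a = x
    · subst h; simp [hx a]
    · rw [wSig_coord Λ h]
  have h1 : ∑ a ∈ Finset.univ.erase x, wSig Λ x u a * wSig Λ x v a =
      ∑ a ∈ Finset.univ.erase x, u a * v a :=
    Finset.sum_congr rfl fun a ha => by
      rw [wSig_coord Λ (Finset.ne_of_mem_erase ha), wSig_coord Λ (Finset.ne_of_mem_erase ha)]
  have h2 : ∑ a ∈ Finset.univ.erase x, ∑ b ∈ Finset.univ.erase x,
        (Λ a b : ℤ) * wSig Λ x u a * wSig Λ x v b =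
      ∑ a ∈ Finset.univ.erase x, ∑ b ∈ Finset.univ.erase x, (Λ a b : ℤ) * u a * v b :=
    Finset.sum_congr rfl fun a ha => Finset.sum_congr rfl fun b hb => by
      rw [wSig_coord Λ (Finset.ne_of_mem_erase ha), wSig_coord Λ (Finset.ne_of_mem_erase hb)]
  rw [h0, h1, h2]
  ring

theorem eul_act {Λ : Fin n → Fin n → ℕ} {T : List (Fin n)} (h : Admissible Λ T)
    (u v : Fin n → ℤ) : eul Λ (act Λ T u) (act Λ T v) = eul (orientAfter Λ T) u v := by
  induction T generalizing Λ with
  | nil => simp [orientAfter]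
  | cons x T ih =>
    rw [orientAfter, ← ih h.2, ← eul_flip h.1]
    simp only [act_cons, act_flip, ← LinearEquiv.mul_apply, ← mul_assoc, wSig_sq, one_mul]

theorem eul_ee_sink {Λ : Fin n → Fin n → ℕ} {x : Fin n} (hx : IsSink Λ x) (v : Fin n → ℤ) :
    eul Λ (ee x) v = v x := by
  rw [eul_sink hx, Finset.sum_eq_zero, Finset.sum_eq_zero, Finset.sum_eq_zero]
  · simp [ee_self]
  · intro a _
    by_cases h : a = x
    · subst h; simp [hx a]
    · simp [ee_ne h]
  · intro a ha
    exact Finset.sum_eq_zero fun b _ => by simp [ee_ne (Finset.ne_of_mem_erase ha)]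
  · intro a ha
    simp [ee_ne (Finset.ne_of_mem_erase ha)]

theorem eul_ee_source {Λ : Fin n → Fin n → ℕ} {x : Fin n} (hx : IsSink Λ x) (v : Fin n → ℤ) :
    eul (flipO x Λ) (ee x) v = - wSig Λ x v x := by
  rw [eul_source hx, sink_reflect hx, Finset.sum_eq_zero, Finset.sum_eq_zero]
  · simp [ee_self]
  · intro a ha
    exact Finset.sum_eq_zero fun b _ => by simp [ee_ne (Finset.ne_of_mem_erase ha)]
  · intro a ha
    simp [ee_ne (Finset.ne_of_mem_erase ha)]

theorem root_eq_ee (Λ : Fin n → Fin n → ℕ) {C : List (Fin n)} {x y : Fin n}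
    (h : ∀ j, 0 ≤ act Λ C (ee y) j) (h' : ¬ ∀ j, 0 ≤ act Λ (x :: C) (ee y) j) :
    act Λ C (ee y) = ee x := by
  have hneg := (sign_coherent Λ (x :: C) y).resolve_left h'
  set v := act Λ C (ee y) with hv
  have hv0 : v = v x • ee x := by
    ext j
    by_cases hj : j = x
    · subst hj; simp [ee_self]
    · have h1 := hneg j
      rw [act_cons, LinearEquiv.mul_apply, wSig_coord Λ hj, ← hv] at h1
      simp [ee_ne hj]
      exact le_antisymm h1 (h j)
  have h1 : v x * (act Λ C).symm (ee x) y = 1 := by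
    have : (act Λ C).symm v = ee y := by simp [hv]
    rw [hv0, map_smul] at this
    have := congrFun this y
    simpa [ee_self] using this
  rcases Int.eq_one_or_neg_one_of_mul_eq_one h1 with h2 | h2
  · rw [hv0, h2, one_smul]
  · have := h x; omega

/-- All roots of all infixes are positive. -/
def PosAll (Λ : Fin n → Fin n → ℕ) (q : List (Fin n)) : Prop :=
  ∀ A C y B, q = A ++ (C ++ y :: B) → ∀ j, 0 ≤ act Λ C (ee y) j

theorem PosAll.posL {Λ : Fin n → Fin n → ℕ} {q : List (Fin n)} (h : PosAll Λ q) : PosL Λ q :=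
  fun A y B hq => h [] A y B (by simpa using hq)

theorem posAll_of_red {Λ : Fin n → Fin n → ℕ} {q : List (Fin n)} (h : Red Λ q) : PosAll Λ q := by
  intro A C y B hq
  subst hq
  exact (red_iff_posL Λ _).1 (Red.right h) C y B rfl

theorem posAll_of_c (S : List (Fin n)) : ∀ (Λ : Fin n → Fin n → ℕ), Admissible Λ S → Qr Λ S →
    (∀ A C y, S = A ++ (C ++ [y]) → ∀ j, 0 ≤ act Λ C (ee y) j) → PosAll Λ S := by
  classical
  induction S with
  | nil => intro Λ _ _ _ A C y B h; simp at h
  | cons x V ih =>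
  intro Λ hadm hQ hc
  have hQflip : ∀ T, Qr Λ T → Qr (flipO x Λ) T := by
    intro T
    induction T with
    | nil => intro _; trivial
    | cons a T ihT => intro h; exact ⟨by rw [edges_flip]; exact h.1, ihT h.2⟩
  have hV : PosAll Λ V := by
    have := ih (flipO x Λ) hadm.2 (hQflip V hQ.2) (by
      intro A C y h
      rw [act_flip]
      exact hc (x :: A) C y (by simp [h]))
    unfold PosAll at this ⊢
    rwa [act_flip] at this
  have main : ∀ C y B, V = C ++ y :: B → ∀ j, 0 ≤ act Λ (x :: C) (ee y) j := by
    intro C y B hCB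
    by_contra hcon
    have e1 := root_eq_ee Λ (hV [] C y B (by simpa using hCB)) hcon
    by_cases hB : B = []
    · subst hB
      exact hcon (hc [] (x :: C) y (by simp [hCB]))
    have hQy : Qr Λ (y :: B) := Qr.right (A := C) (by rw [← hCB]; exact hQ.2)
    have hex := hQy.1 hB
    -- the first letter adjacent to `y`
    have hfirst : ∃ D m B', B = D ++ m :: B' ∧ edges Λ y m ≠ 0 ∧ ∀ d ∈ D, edges Λ y d = 0 := by
      clear hQy hcon e1 hCB hB
      induction B with
      | nil => simp at hex
      | cons b B ihB =>
        by_cases hb : edges Λ y b = 0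
        · obtain ⟨D, m, B', h1, h2, h3⟩ := ihB (by
            obtain ⟨c, hc, hyc⟩ := hex
            rcases List.mem_cons.1 hc with rfl | hc
            · exact absurd hb hyc
            · exact ⟨c, hc, hyc⟩)
          refine ⟨b :: D, m, B', by simp [h1], h2, ?_⟩
          intro d hd
          rcases List.mem_cons.1 hd with rfl | hd
          · exact hb
          · exact h3 d hd
        · exact ⟨[], b, B, rfl, hb, by simp⟩
    obtain ⟨D, m, B', hBD, hym, hD⟩ := hfirst
    have hmD : m ∉ D := fun h => hym (hD m h)
    subst hBD
    subst hCB
    have hadmV : Admissible (flipO x Λ) (C ++ (y :: D ++ m :: B')) := by simpa using hadm.2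
    have hadmy := hadmV.right
    set Λj := orientAfter (flipO x Λ) C with hΛj
    have hEj : edges Λj = edges Λ := by rw [hΛj, edges_orientAfter, edges_flip]
    have hysink : IsSink Λj y := hadmy.1
    have hmy : m ≠ y := by
      rintro rfl
      rw [← hEj] at hym
      simp [edges, hysink m] at hym
    have hΛmy : Λj m y ≠ 0 := by
      rw [← hEj] at hym
      simpa [edges, hysink m] using hym
    have hyD : y ∉ D := by
      have h2 : Admissible (flipO y Λj) (D ++ m :: B') := hadmy.2
      exact not_mem_of_adm (a := y) (c := m) (by simpa [flipO] using hΛmy) h2.left hmD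
    set u := act Λ D (ee m) with hu
    have hu0 : ∀ j, 0 ≤ u j := hV (C ++ [y]) D m B' (by simp)
    have hum : u m = 1 := by rw [hu, act_coord Λ hmD, ee_self]
    have huy : u y = 0 := by rw [hu, act_coord Λ hyD, ee_ne hmy.symm]
    have hactj : wSig Λj = wSig Λ := by
      funext i; ext1 v
      have : cartanOf Λj = cartanOf Λ := by
        funext i j; simp [cartanOf, hEj]
      simp [wSig_apply, cB_apply, this]
    have hpos : 1 ≤ wSig Λ y u y := by
      rw [← hactj, sink_reflect hysink, huy, sub_zero]
      have h1 : (Λj m y : ℤ) * u m ≤ ∑ b, (Λj b y : ℤ) * u b :=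
        Finset.single_le_sum (f := fun b => (Λj b y : ℤ) * u b)
          (fun b _ => mul_nonneg (by positivity) (hu0 b)) (Finset.mem_univ m)
      rw [hum, mul_one] at h1
      have : (1 : ℤ) ≤ Λj m y := by exact_mod_cast Nat.one_le_iff_ne_zero.2 hΛmy
      omega
    have heul : eul (flipO x Λ) (ee x) (act Λ C (wSig Λ y u)) = wSig Λ y u y := by
      rw [← e1, ← act_flip x Λ, eul_act (Admissible.left hadmV), ← hΛj, eul_ee_sink hysink]
    rw [eul_ee_source hadm.1] at heul
    have hact2 : act Λ (C ++ y :: D) (ee m) = act Λ C (wSig Λ y u) := by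
      simp [hu, LinearEquiv.mul_apply]
    have e2 := root_eq_ee Λ (x := x) (hV [] (C ++ y :: D) m B' (by simp)) (by
      intro hall
      have := hall x
      rw [act_cons, LinearEquiv.mul_apply, hact2] at this
      omega)
    rw [hact2, ← e1] at e2
    have e3 := (act Λ C).injective e2
    have := congrFun e3 m
    rw [wSig_coord Λ hmy, hum, ee_ne hmy] at this
    omega
  intro A C y B h
  cases A with
  | cons a A =>
    simp only [List.cons_append, List.cons.injEq] at h
    exact hV A C y B h.2
  | nil =>
    cases C with
    | nil => intro j; simpa using ee_nonneg y j
    | cons c C =>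
      simp only [List.nil_append, List.cons_append, List.cons.injEq] at h
      obtain ⟨rfl, h⟩ := h
      exact main C y B h

end Comb

section Reps

theorem dim_zero_of {m : ℕ} (h : ∀ v : Fin m → k, v = 0) : m = 0 := by
  by_contra hm
  have := congrFun (h fun _ => 1) ⟨0, Nat.pos_of_ne_zero hm⟩
  simp at this

theorem vec_zero_of {m : ℕ} (hm : m = 0) (v : Fin m → k) : v = 0 := by
  subst hm; exact Subsingleton.elim _ _

/-- Indecomposability through idempotent endomorphisms. -/
def IdemIndec {Λ : Fin n → Fin n → ℕ} (M : Rep k n Λ) : Prop :=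
  ¬ IsZeroRep M ∧ ∀ e : ∀ z, (Fin (M.d z) → k) →ₗ[k] (Fin (M.d z) → k),
    (∀ a b i v, e b (M.f a b i v) = M.f a b i (e a v)) → (∀ z v, e z (e z v) = e z v) →
    (∀ z v, e z v = 0) ∨ (∀ z v, e z v = v)

/-- A subrepresentation. -/
noncomputable def subRep {Λ : Fin n → Fin n → ℕ} (M : Rep k n Λ)
    (U : ∀ z, Submodule k (Fin (M.d z) → k))
    (hU : ∀ a b i, ∀ v ∈ U a, M.f a b i v ∈ U b) : Rep k n Λ where
  d z := Module.finrank k (U z)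
  f a b i := (Module.finBasis k (U b)).equivFun.toLinearMap ∘ₗ
    ((M.f a b i).restrict (hU a b i)) ∘ₗ (Module.finBasis k (U a)).equivFun.symm.toLinearMap

/-- The coordinates on a subrepresentation. -/
noncomputable def subE {Λ : Fin n → Fin n → ℕ} (M : Rep k n Λ)
    (U : ∀ z, Submodule k (Fin (M.d z) → k))
    (hU : ∀ a b i, ∀ v ∈ U a, M.f a b i v ∈ U b) (z : Fin n) :
    U z ≃ₗ[k] (Fin ((subRep M U hU).d z) → k) := (Module.finBasis k (U z)).equivFun

theorem subRep_f_apply {Λ : Fin n → Fin n → ℕ} (M : Rep k n Λ)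
    (U : ∀ z, Submodule k (Fin (M.d z) → k))
    (hU : ∀ a b i, ∀ v ∈ U a, M.f a b i v ∈ U b) (a b i) (u : U a) :
    (subRep M U hU).f a b i (subE M U hU a u) =
      subE M U hU b ((M.f a b i).restrict (hU a b i) u) :=
  congrArg (fun t => (Module.finBasis k (U b)).equivFun ((M.f a b i).restrict (hU a b i) t))
    ((Module.finBasis k (U a)).equivFun.symm_apply_apply u)

/-- The splitting of the space of a direct sum. -/
def splitD {Λ : Fin n → Fin n → ℕ} (A B : Rep k n Λ) (z : Fin n) :
    (Fin ((dSum A B).d z) → k) ≃ₗ[k] (Fin (A.d z) → k) × (Fin (B.d z) → k) :=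
  splitL k (A.d z) (B.d z)

theorem dSum_f_apply {Λ : Fin n → Fin n → ℕ} (A B : Rep k n Λ) (a b : Fin n) (i : Fin (Λ a b))
    (v : Fin ((dSum A B).d a) → k) :
    splitD A B b ((dSum A B).f a b i v) =
      (A.f a b i (splitD A B a v).1, B.f a b i (splitD A B a v).2) :=
  LinearEquiv.apply_symm_apply (splitL k (A.d b) (B.d b)) _

theorem iso_of_compl {Λ : Fin n → Fin n → ℕ} (M : Rep k n Λ)
    (U W : ∀ z, Submodule k (Fin (M.d z) → k))
    (hU : ∀ a b i, ∀ v ∈ U a, M.f a b i v ∈ U b)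
    (hW : ∀ a b i, ∀ v ∈ W a, M.f a b i v ∈ W b)
    (hc : ∀ z, IsCompl (U z) (W z)) : RepIso M (dSum (subRep M U hU) (subRep M W hW)) := by
  let G : ∀ z, (U z × W z) ≃ₗ[k] (Fin ((subRep M U hU).d z) → k) ×
      (Fin ((subRep M W hW).d z) → k) := fun z =>
    LinearEquiv.prodCongr (subE M U hU z) (subE M W hW z)
  refine ⟨fun z => (Submodule.prodEquivOfIsCompl (U z) (W z) (hc z)).symm.trans
    ((G z).trans (splitD (subRep M U hU) (subRep M W hW) z).symm), ?_⟩
  intro a b i v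
  obtain ⟨⟨u, w⟩, rfl⟩ := (Submodule.prodEquivOfIsCompl (U a) (W a) (hc a)).surjective v
  have h1 : M.f a b i ((Submodule.prodEquivOfIsCompl (U a) (W a) (hc a)) (u, w)) =
      (Submodule.prodEquivOfIsCompl (U b) (W b) (hc b))
        ((M.f a b i).restrict (hU a b i) u, (M.f a b i).restrict (hW a b i) w) := by
    simp [Submodule.coe_prodEquivOfIsCompl']
  rw [h1]
  simp only [LinearEquiv.trans_apply, LinearEquiv.symm_apply_apply]
  apply (splitD (subRep M U hU) (subRep M W hW) b).injective
  rw [dSum_f_apply, LinearEquiv.apply_symm_apply, LinearEquiv.apply_symm_apply]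
  simp only [G, LinearEquiv.prodCongr_apply, subRep_f_apply]

theorem Indecomp.idem {Λ : Fin n → Fin n → ℕ} {M : Rep k n Λ} (h : Indecomp M) : IdemIndec M := by
  refine ⟨h.1, fun e hcomm hidem => ?_⟩
  have hc : ∀ z, IsCompl (LinearMap.range (e z)) (LinearMap.ker (e z)) := by
    intro z
    constructor
    · rw [Submodule.disjoint_def]
      rintro _ ⟨v, rfl⟩ hv
      rw [LinearMap.mem_ker, hidem] at hv
      exact hv
    · rw [codisjoint_iff, eq_top_iff]
      intro v _
      rw [Submodule.mem_sup]
      exact ⟨e z v, ⟨v, rfl⟩, v - e z v, by simp [hidem], by simp⟩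
  have hU : ∀ a b i, ∀ v ∈ LinearMap.range (e a), M.f a b i v ∈ LinearMap.range (e b) := by
    rintro a b i _ ⟨v, rfl⟩
    exact ⟨M.f a b i v, hcomm a b i v⟩
  have hW : ∀ a b i, ∀ v ∈ LinearMap.ker (e a), M.f a b i v ∈ LinearMap.ker (e b) := by
    intro a b i v hv
    rw [LinearMap.mem_ker] at *
    rw [hcomm, hv, map_zero]
  rcases h.2 _ _ (iso_of_compl M _ _ hU hW hc) with h0 | h0
  · left
    intro z v
    have h1 : Module.finrank k (LinearMap.range (e z)) = 0 := h0 z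
    rw [Submodule.finrank_eq_zero] at h1
    have : e z v ∈ LinearMap.range (e z) := ⟨v, rfl⟩
    rw [h1] at this
    exact this
  · right
    intro z v
    have h1 : Module.finrank k (LinearMap.ker (e z)) = 0 := h0 z
    rw [Submodule.finrank_eq_zero] at h1
    have : v - e z v ∈ LinearMap.ker (e z) := by simp [hidem]
    rw [h1, Submodule.mem_bot, sub_eq_zero] at this
    exact this.symm

theorem IdemIndec.indecomp {Λ : Fin n → Fin n → ℕ} {M : Rep k n Λ} (h : IdemIndec M) :
    Indecomp M := by
  refine ⟨h.1, ?_⟩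
  rintro A B ⟨g, hg⟩
  let G : ∀ z, (Fin (M.d z) → k) ≃ₗ[k] (Fin (A.d z) → k) × (Fin (B.d z) → k) := fun z =>
    (g z).trans (splitD A B z)
  have hG : ∀ a b i v, G b (M.f a b i v) = (A.f a b i (G a v).1, B.f a b i (G a v).2) := by
    intro a b i v
    simp only [G, LinearEquiv.trans_apply, hg]
    exact dSum_f_apply A B a b i (g a v)
  have hcm : ∀ a b i v, (fun z => (G z).symm.toLinearMap ∘ₗ
      (LinearMap.prodMap LinearMap.id 0) ∘ₗ (G z).toLinearMap) b (M.f a b i v) =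
      M.f a b i ((fun z => (G z).symm.toLinearMap ∘ₗ
      (LinearMap.prodMap LinearMap.id 0) ∘ₗ (G z).toLinearMap) a v) := by
    intro a b i v
    apply (G b).injective
    simp only [LinearMap.comp_apply, LinearEquiv.coe_coe, LinearEquiv.apply_symm_apply, hG]
    simp
  rcases h.2 (fun z => (G z).symm.toLinearMap ∘ₗ
      (LinearMap.prodMap LinearMap.id 0) ∘ₗ (G z).toLinearMap) hcm (by intro z v; simp) with h0 | h0
  · left
    intro z
    refine dim_zero_of (k := k) fun v => ?_
    have := h0 z ((G z).symm (v, 0))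
    simpa using this
  · right
    intro z
    refine dim_zero_of (k := k) fun v => ?_
    have := h0 z ((G z).symm (0, v))
    simpa [eq_comm] using this

/-- The integral dimension vector. -/
def dimV {Λ : Fin n → Fin n → ℕ} (M : Rep k n Λ) : Fin n → ℤ := fun z => (M.d z : ℤ)

theorem inMap_apply (Λ : Fin n → Fin n → ℕ) (M : Rep k n Λ) (x : Fin n)
    (v : (p : Arin Λ x) → (Fin (M.d p.1) → k)) :
    inMap Λ M x v = ∑ p : Arin Λ x, M.f p.1 x p.2 (v p) := by
  simp [inMap, LinearMap.sum_apply]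

theorem exists_functional {V : Type*} [AddCommGroup V] [Module k V] (U : Submodule k V) {v : V}
    (hv : v ∉ U) : ∃ l : V →ₗ[k] k, (∀ u ∈ U, l u = 0) ∧ l v = 1 := by
  obtain ⟨l, hl, hU⟩ := Submodule.exists_le_ker_of_notMem hv
  refine ⟨(l v)⁻¹ • l, fun u hu => ?_, ?_⟩
  · have : l u = 0 := hU hu
    simp [this]
  · simp [hl]

/-- If a rank one idempotent concentrated at `x` commutes with everything then `M` is simple. -/
theorem simple_of_rank_one {Λ : Fin n → Fin n → ℕ} {M : Rep k n Λ} (h : IdemIndec M) (x : Fin n)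
    (l : (Fin (M.d x) → k) →ₗ[k] k) (v : Fin (M.d x) → k) (hlv : l v = 1)
    (hin : ∀ a i u, l (M.f a x i u) = 0) (hout : ∀ b i, M.f x b i v = 0) :
    dimV M = ee x := by
  classical
  have hv0 : v ≠ 0 := by rintro rfl; simp at hlv
  let e : ∀ z, (Fin (M.d z) → k) →ₗ[k] (Fin (M.d z) → k) :=
    Function.update (fun z => 0) x (LinearMap.toSpanSingleton k _ v ∘ₗ l)
  have ex : ∀ u, e x u = l u • v := fun u => by simp [e]
  have ene : ∀ z, z ≠ x → ∀ u, e z u = 0 := fun z hz u => by simp [e, hz]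
  have hc1 : ∀ a b i u, e b (M.f a b i u) = M.f a b i (e a u) := by
    intro a b i u
    by_cases hb : b = x
    · subst hb
      rw [ex, hin, zero_smul]
      by_cases ha : a = b
      · subst ha
        rw [ex, map_smul, hout, smul_zero]
      · rw [ene a ha, map_zero]
    · rw [ene b hb]
      by_cases ha : a = x
      · subst ha
        rw [ex, map_smul, hout, smul_zero]
      · rw [ene a ha, map_zero]
  have hc2 : ∀ z u, e z (e z u) = e z u := by
    intro z u
    by_cases hz : z = x
    · subst hz
      simp [ex, hlv]
    · simp [ene z hz]
  rcases h.2 e hc1 hc2 with h0 | h0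
  · exact absurd (by simpa [ex, hlv] using h0 x v) hv0
  · funext z
    by_cases hz : z = x
    · subst hz
      have h1 : Module.finrank k (Fin (M.d z) → k) = 1 := by
        refine finrank_eq_one v hv0 fun w => ⟨l w, ?_⟩
        rw [← ex, h0]
      simp at h1
      simp [dimV, h1, ee_self]
    · rw [ee_ne hz]
      have : M.d z = 0 := dim_zero_of (k := k) fun u => by rw [← h0 z u, ene z hz]
      simp [dimV, this]

theorem inMap_surj {Λ : Fin n → Fin n → ℕ} {M : Rep k n Λ} (h : IdemIndec M) {x : Fin n}
    (hx : IsSink Λ x) (hM : dimV M ≠ ee x) : Function.Surjective (inMap Λ M x) := by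
  classical
  rw [← LinearMap.range_eq_top]
  by_contra hcon
  obtain ⟨v, -, hv⟩ := SetLike.exists_of_lt (lt_top_iff_ne_top.2 hcon)
  obtain ⟨l, hl, hlv⟩ := exists_functional _ hv
  refine hM (simple_of_rank_one h x l v hlv ?_ ?_)
  · intro a i u
    apply hl
    refine ⟨Pi.single (⟨a, i⟩ : Arin Λ x) u, ?_⟩
    rw [inMap_apply, Finset.sum_eq_single (⟨a, i⟩ : Arin Λ x)]
    · simp
    · intro p _ hp
      simp [Pi.single_eq_of_ne hp]
    · simp
  · intro b i
    exact (Fin.cast (hx b) i).elim0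

theorem outMap_inj {Λ : Fin n → Fin n → ℕ} {x : Fin n} {N : Rep k n (flipO x Λ)} (h : IdemIndec N)
    (hx : IsSink Λ x) (hN : dimV N ≠ ee x) :
    Function.Injective (outMap (flipO x Λ) N x) := by
  rw [← LinearMap.ker_eq_bot]
  by_contra hcon
  obtain ⟨v, hv, hv0⟩ := Submodule.exists_mem_ne_zero_of_ne_bot hcon
  obtain ⟨l, -, hlv⟩ := exists_functional (⊥ : Submodule k (Fin (N.d x) → k)) (v := v) (by simpa)
  refine hN (simple_of_rank_one h x l v hlv ?_ ?_)
  · intro a i u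
    exact (Fin.cast (by simp [flipO, hx a]) i : Fin 0).elim0
  · intro b i
    have := congrFun (LinearMap.mem_ker.1 hv) (⟨b, i⟩ : Aout (flipO x Λ) x)
    exact this

/-- The exact relation between `M` and its reflection `N`. -/
structure Ex (x : Fin n) (Λ : Fin n → Fin n → ℕ) (M : Rep k n Λ) (N : Rep k n (flipO x Λ)) where
  φ : ∀ z, z ≠ x → ((Fin (M.d z) → k) ≃ₗ[k] (Fin (N.d z) → k))
  hφ : ∀ a b (ha : a ≠ x) (hb : b ≠ x) (i : Fin (flipO x Λ a b)) v,
    N.f a b i (φ a ha v) = φ b hb (M.f a b (Fin.cast (by simp [flipO, ha, hb]) i) v)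
  ι : (Fin (N.d x) → k) →ₗ[k] ((p : Arin Λ x) → (Fin (M.d p.1) → k))
  hι : ∀ b (hb : b ≠ x) (i : Fin (flipO x Λ x b)) v,
    N.f x b i v = φ b hb (ι v (⟨b, Fin.cast (by simp [flipO]) i⟩ : Arin Λ x))
  inj : Function.Injective ι
  exact : LinearMap.range ι = LinearMap.ker (inMap Λ M x)
  surj : Function.Surjective (inMap Λ M x)

end Reps

section Transfer

theorem sink_arin_ne {Λ : Fin n → Fin n → ℕ} {x : Fin n} (hx : IsSink Λ x) (p : Arin Λ x) :
    p.1 ≠ x := by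
  obtain ⟨y, i⟩ := p
  intro h
  have h' : y = x := h
  subst h'
  exact (Fin.cast (hx _) i).elim0

theorem inMap_single (Λ : Fin n → Fin n → ℕ) (M : Rep k n Λ) (x : Fin n) (p : Arin Λ x)
    (v : Fin (M.d p.1) → k) : inMap Λ M x (Pi.single p v) = M.f p.1 x p.2 v := by
  rw [inMap_apply, Finset.sum_eq_single p]
  · simp
  · intro q _ hq
    simp [Pi.single_eq_of_ne hq]
  · simp

theorem Ex.up {x : Fin n} {Λ : Fin n → Fin n → ℕ} {M : Rep k n Λ} {N : Rep k n (flipO x Λ)}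
    (hx : IsSink Λ x) (X : Ex x Λ M N) (h : IdemIndec M) : IdemIndec N := by
  classical
  have hp := fun p => sink_arin_ne hx p
  refine ⟨fun hN => h.1 ?_, fun e' hc' hi' => ?_⟩
  · have h1 : ∀ z, z ≠ x → M.d z = 0 := fun z hz => dim_zero_of (k := k) fun v => by
      apply (X.φ z hz).injective
      rw [map_zero]
      exact vec_zero_of (hN z) _
    intro z
    by_cases hz : z = x
    · subst hz
      refine dim_zero_of (k := k) fun v => ?_
      obtain ⟨w, rfl⟩ := X.surj v
      have : w = 0 := funext fun p => vec_zero_of (h1 _ (hp p)) _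
      rw [this, map_zero]
    · exact h1 z hz
  let ψ : ∀ z, z ≠ x → (Fin (M.d z) → k) →ₗ[k] (Fin (M.d z) → k) := fun z hz =>
    (X.φ z hz).symm.toLinearMap ∘ₗ e' z ∘ₗ (X.φ z hz).toLinearMap
  have hψ : ∀ z hz v, X.φ z hz (ψ z hz v) = e' z (X.φ z hz v) := fun z hz v => by simp [ψ]
  have hψi : ∀ z hz v, ψ z hz (ψ z hz v) = ψ z hz v := fun z hz v => by
    apply (X.φ z hz).injective
    rw [hψ, hψ, hi']
  let E : ((p : Arin Λ x) → (Fin (M.d p.1) → k)) →ₗ[k] ((p : Arin Λ x) → (Fin (M.d p.1) → k)) :=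
    LinearMap.pi fun p => ψ p.1 (hp p) ∘ₗ LinearMap.proj p
  have hE : ∀ w p, E w p = ψ p.1 (hp p) (w p) := fun w p => rfl
  have hEι : ∀ v, X.ι (e' x v) = E (X.ι v) := by
    intro v
    funext p
    apply (X.φ p.1 (hp p)).injective
    rw [hE, hψ]
    have h1 := X.hι p.1 (hp p) (Fin.cast (by simp [flipO]) p.2) (e' x v)
    have h2 := X.hι p.1 (hp p) (Fin.cast (by simp [flipO]) p.2) v
    rw [← hc', h2] at h1
    exact h1.symm
  obtain ⟨s, hs⟩ := LinearMap.exists_rightInverse_of_surjective _ (LinearMap.range_eq_top.2 X.surj)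
  have hs' : ∀ v, inMap Λ M x (s v) = v := fun v => LinearMap.congr_fun hs v
  let e : ∀ z, (Fin (M.d z) → k) →ₗ[k] (Fin (M.d z) → k) :=
    Function.update (fun z => if hz : z ≠ x then ψ z hz else 0) x (inMap Λ M x ∘ₗ E ∘ₗ s)
  have ene : ∀ z (hz : z ≠ x) v, e z v = ψ z hz v := fun z hz v => by simp [e, hz]
  have ex : ∀ w, e x (inMap Λ M x w) = inMap Λ M x (E w) := by
    intro w
    have h1 : s (inMap Λ M x w) - w ∈ LinearMap.range X.ι := by
      rw [X.exact, LinearMap.mem_ker, map_sub, hs', sub_self]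
    obtain ⟨u, hu⟩ := h1
    have h2 : inMap Λ M x (X.ι (e' x u)) = 0 := by
      rw [← LinearMap.mem_ker, ← X.exact]; exact ⟨_, rfl⟩
    rw [hEι, hu, map_sub, map_sub, sub_eq_zero] at h2
    rw [← h2]
    simp [e]
  have hc : ∀ a b i u, e b (M.f a b i u) = M.f a b i (e a u) := by
    intro a b i u
    by_cases ha : a = x
    · subst ha
      exact (Fin.cast (hx _) i).elim0
    by_cases hb : b = x
    · subst hb
      have h1 := inMap_single Λ M b ⟨a, i⟩ u
      have h2 := inMap_single Λ M b ⟨a, i⟩ (e a u)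
      simp only at h1 h2
      rw [← h1, ← h2, ex]
      congr 1
      funext p
      rw [hE]
      by_cases hq : p = ⟨a, i⟩
      · subst hq
        simp [ene a ha]
      · simp [Pi.single_eq_of_ne hq]
    · rw [ene b hb, ene a ha]
      apply (X.φ b hb).injective
      rw [hψ]
      have h1 := X.hφ a b ha hb (Fin.cast (by simp [flipO, ha, hb]) i) u
      have h2 := X.hφ a b ha hb (Fin.cast (by simp [flipO, ha, hb]) i) (ψ a ha u)
      simp only [Fin.cast_cast, Fin.cast_eq_self] at h1 h2
      rw [← h1, ← h2, hψ, hc']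
  have hi : ∀ z u, e z (e z u) = e z u := by
    intro z u
    by_cases hz : z = x
    · subst hz
      obtain ⟨w, rfl⟩ := X.surj u
      rw [ex, ex]
      congr 1
      funext p
      simp only [hE, hψi]
    · simp only [ene z hz, hψi]
  rcases h.2 e hc hi with h0 | h0
  · left
    have h1 : ∀ z (hz : z ≠ x) v, ψ z hz v = 0 := fun z hz v => by rw [← ene, h0]
    intro z v
    by_cases hz : z = x
    · subst hz
      apply X.inj
      rw [hEι, map_zero]
      funext p
      rw [hE, h1]; rfl
    · obtain ⟨u, rfl⟩ := (X.φ z hz).surjective v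
      rw [← hψ, h1, map_zero]
  · right
    have h1 : ∀ z (hz : z ≠ x) v, ψ z hz v = v := fun z hz v => by rw [← ene, h0]
    intro z v
    by_cases hz : z = x
    · subst hz
      apply X.inj
      rw [hEι]
      funext p
      rw [hE, h1]
    · obtain ⟨u, rfl⟩ := (X.φ z hz).surjective v
      rw [← hψ, h1]

theorem Ex.down {x : Fin n} {Λ : Fin n → Fin n → ℕ} {M : Rep k n Λ} {N : Rep k n (flipO x Λ)}
    (hx : IsSink Λ x) (X : Ex x Λ M N) (h : IdemIndec N) : IdemIndec M := by
  classical
  have hp := fun p => sink_arin_ne hx p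
  refine ⟨fun hM => h.1 ?_, fun e hc hi => ?_⟩
  · intro z
    refine dim_zero_of (k := k) fun v => ?_
    by_cases hz : z = x
    · subst hz
      apply X.inj
      rw [map_zero]
      exact funext fun p => vec_zero_of (hM _) _
    · obtain ⟨u, rfl⟩ := (X.φ z hz).surjective v
      rw [vec_zero_of (hM z) u, map_zero]
  let ψ : ∀ z, z ≠ x → (Fin (N.d z) → k) →ₗ[k] (Fin (N.d z) → k) := fun z hz =>
    (X.φ z hz).toLinearMap ∘ₗ e z ∘ₗ (X.φ z hz).symm.toLinearMap
  have hψ : ∀ z hz v, ψ z hz (X.φ z hz v) = X.φ z hz (e z v) := fun z hz v => by simp [ψ]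
  let E : ((p : Arin Λ x) → (Fin (M.d p.1) → k)) →ₗ[k] ((p : Arin Λ x) → (Fin (M.d p.1) → k)) :=
    LinearMap.pi fun p => e p.1 ∘ₗ LinearMap.proj p
  have hE : ∀ w p, E w p = e p.1 (w p) := fun w p => rfl
  have hEin : ∀ w, inMap Λ M x (E w) = e x (inMap Λ M x w) := by
    intro w
    simp only [inMap_apply, map_sum, hE, hc]
  obtain ⟨r, hr⟩ := LinearMap.exists_leftInverse_of_injective X.ι (LinearMap.ker_eq_bot.2 X.inj)
  have hr' : ∀ v, r (X.ι v) = v := fun v => LinearMap.congr_fun hr v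
  let e' : ∀ z, (Fin (N.d z) → k) →ₗ[k] (Fin (N.d z) → k) :=
    Function.update (fun z => if hz : z ≠ x then ψ z hz else 0) x (r ∘ₗ E ∘ₗ X.ι)
  have ene : ∀ z (hz : z ≠ x) v, e' z (X.φ z hz v) = X.φ z hz (e z v) := fun z hz v => by
    rw [← hψ]; simp [e', hz]
  have ex : ∀ v, X.ι (e' x v) = E (X.ι v) := by
    intro v
    have h1 : E (X.ι v) ∈ LinearMap.range X.ι := by
      rw [X.exact, LinearMap.mem_ker, hEin]
      have : inMap Λ M x (X.ι v) = 0 := by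
        rw [← LinearMap.mem_ker, ← X.exact]; exact ⟨_, rfl⟩
      rw [this, map_zero]
    obtain ⟨u, hu⟩ := h1
    have : e' x v = r (E (X.ι v)) := by simp [e']
    rw [this, ← hu, hr']
  have hc' : ∀ a b i u, e' b (N.f a b i u) = N.f a b i (e' a u) := by
    intro a b i u
    by_cases hb : b = x
    · subst hb
      exact (Fin.cast (by simp [flipO, hx a]) i : Fin 0).elim0
    by_cases ha : a = x
    · subst ha
      rw [X.hι b hb, X.hι b hb, ene, ex, hE]
    · obtain ⟨u, rfl⟩ := (X.φ a ha).surjective u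
      rw [X.hφ a b ha hb, ene, ene, X.hφ a b ha hb, hc]
  have hi' : ∀ z u, e' z (e' z u) = e' z u := by
    intro z u
    by_cases hz : z = x
    · subst hz
      apply X.inj
      simp only [ex]
      funext p
      simp only [hE, hi]
    · obtain ⟨u, rfl⟩ := (X.φ z hz).surjective u
      rw [ene, ene, hi]
  rcases h.2 e' hc' hi' with h0 | h0
  · left
    have h1 : ∀ z (_ : z ≠ x) v, e z v = 0 := fun z hz v => by
      apply (X.φ z hz).injective
      rw [← ene, h0, map_zero]
    intro z v
    by_cases hz : z = x
    · subst hz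
      obtain ⟨w, rfl⟩ := X.surj v
      rw [← hEin]
      have : E w = 0 := funext fun p => by rw [hE, h1 _ (hp p)]; rfl
      rw [this, map_zero]
    · exact h1 z hz v
  · right
    have h1 : ∀ z (_ : z ≠ x) v, e z v = v := fun z hz v => by
      apply (X.φ z hz).injective
      rw [← ene, h0]
    intro z v
    by_cases hz : z = x
    · subst hz
      obtain ⟨w, rfl⟩ := X.surj v
      rw [← hEin]
      have : E w = w := funext fun p => by rw [hE, h1 _ (hp p)]
      rw [this]
    · exact h1 z hz v

theorem Ex.dim {x : Fin n} {Λ : Fin n → Fin n → ℕ} {M : Rep k n Λ} {N : Rep k n (flipO x Λ)}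
    (hx : IsSink Λ x) (X : Ex x Λ M N) : dimV N = wSig Λ x (dimV M) := by
  funext z
  by_cases hz : z = x
  · subst hz
    rw [sink_reflect hx]
    have h1 := LinearMap.finrank_range_add_finrank_ker (inMap Λ M z)
    rw [LinearMap.range_eq_top.2 X.surj, finrank_top, ← X.exact,
      LinearMap.finrank_range_of_inj X.inj]
      at h1
    have h3 : Module.finrank k ((p : Arin Λ z) → (Fin (M.d p.1) → k)) =
        ∑ p : Arin Λ z, Module.finrank k (Fin (M.d p.1) → k) := Module.finrank_pi_fintype k
    rw [h3] at h1
    simp only [Module.finrank_fintype_fun_eq_card, Fintype.card_fin, Fintype.sum_sigma,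
      Finset.sum_const, Finset.card_univ, smul_eq_mul] at h1
    have h2 : (M.d z : ℤ) + N.d z = ∑ b, (Λ b z : ℤ) * M.d b := by exact_mod_cast h1
    simp only [dimV]
    linarith
  · rw [wSig_coord Λ hz]
    have := (X.φ z hz).finrank_eq
    simp at this
    simp [dimV, this]

end Transfer

section Refl

theorem castL_symm_cast {m m' : ℕ} (h : m = m') (v : Fin m → k) :
    castL k h.symm (castL k h v) = v := by
  subst h; rfl

theorem castL_cast_symm {m m' : ℕ} (h : m' = m) (v : Fin m → k) :
    castL k h (castL k h.symm v) = v := by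
  subst h; rfl

/-- The exact sequence attached to the positive reflection. -/
noncomputable def exPlus (x : Fin n) (Λ : Fin n → Fin n → ℕ) (M : Rep k n Λ)
    (hs : Function.Surjective (inMap Λ M x)) : Ex x Λ M (reflPlus x Λ M) where
  φ z hz := castL k (if_neg hz).symm
  hφ a b ha hb i v := by
    have h1 : (reflPlus x Λ M).f a b i = (castL k (if_neg hb).symm).toLinearMap ∘ₗ
          M.f a b (Fin.cast (by simp [flipO, ha, hb]) i) ∘ₗ
          (castL k (if_neg ha)).toLinearMap := by
      simp only [reflPlus]
      rw [dif_neg ha, dif_neg hb]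
    rw [h1]
    exact congrArg (fun t => castL k (if_neg hb).symm (M.f a b (Fin.cast _ i) t))
      (castL_cast_symm (if_neg ha) v)
  ι := (LinearMap.ker (inMap Λ M x)).subtype ∘ₗ
          (kerEquiv Λ M x).symm.toLinearMap ∘ₗ (castL k (if_pos rfl)).toLinearMap
  hι b hb i v := by
    have h1 : (reflPlus x Λ M).f x b i = (castL k (if_neg hb).symm).toLinearMap ∘ₗ
          (LinearMap.proj (φ := fun p : Arin Λ x => Fin (M.d p.1) → k)
            (⟨b, Fin.cast (by simp [flipO]) i⟩ : Arin Λ x)) ∘ₗ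
          (LinearMap.ker (inMap Λ M x)).subtype ∘ₗ
          (kerEquiv Λ M x).symm.toLinearMap ∘ₗ (castL k (if_pos rfl)).toLinearMap := by
      exact (dif_pos rfl).trans (dif_neg hb)
    rw [h1]
    rfl
  inj := Subtype.val_injective.comp
    ((kerEquiv Λ M x).symm.injective.comp (castL k (if_pos rfl)).injective)
  exact := by
    apply le_antisymm
    · rintro _ ⟨v, rfl⟩
      exact Subtype.property _
    · intro w hw
      refine ⟨(castL k (if_pos rfl)).symm (kerEquiv Λ M x ⟨w, hw⟩), ?_⟩
      have : (castL k (if_pos rfl : (if x = x then Module.finrank k (LinearMap.ker (inMap Λ M x))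
        else M.d x) = _)) ((castL k (if_pos rfl)).symm (kerEquiv Λ M x ⟨w, hw⟩)) =
          kerEquiv Λ M x ⟨w, hw⟩ := LinearEquiv.apply_symm_apply _ _
      refine (congrArg (fun t => ((kerEquiv Λ M x).symm t).1) this).trans ?_
      simp
  surj := hs

theorem exMinus (x : Fin n) (Λ : Fin n → Fin n → ℕ) (hx : IsSink Λ x) (N : Rep k n (flipO x Λ))
    (hs : Function.Injective (outMap (flipO x Λ) N x)) :
    Nonempty (Ex x Λ (reflMinus x Λ N) N) := by
  classical
  have hp := fun p => sink_arin_ne hx p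
  let M := reflMinus x Λ N
  have hc : ∀ p : Aout (flipO x Λ) x, Λ p.1 x = flipO x Λ x p.1 := fun p => by simp [flipO]
  have hc' : ∀ p : Arin Λ x, flipO x Λ x p.1 = Λ p.1 x := fun p => by simp [flipO]
  let φ : ∀ z, z ≠ x → ((Fin (M.d z) → k) ≃ₗ[k] (Fin (N.d z) → k)) := fun z hz =>
    castL k (if_neg hz)
  let cp : Arin Λ x → Aout (flipO x Λ) x := fun p => ⟨p.1, Fin.cast (hc' p).symm p.2⟩
  let ι : (Fin (N.d x) → k) →ₗ[k] ((p : Arin Λ x) → (Fin (M.d p.1) → k)) :=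
    LinearMap.pi fun p => (φ p.1 (hp p)).symm.toLinearMap ∘ₗ N.f x p.1 (Fin.cast (hc' p).symm p.2)
  have hι : ∀ v p, φ p.1 (hp p) (ι v p) = N.f x p.1 (Fin.cast (hc' p).symm p.2) v := by
    intro v p
    simp [ι]
  -- comparison of the two products
  have hpo : ∀ p : Aout (flipO x Λ) x, p.1 ≠ x := by
    rintro ⟨y, i⟩ h
    have h' : y = x := h
    subst h'
    exact (Fin.cast (by simp [flipO, hx y]) i : Fin 0).elim0
  let T : ((p : Arin Λ x) → (Fin (M.d p.1) → k)) →ₗ[k]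
      ((p : Aout (flipO x Λ) x) → (Fin (N.d p.1) → k)) :=
    LinearMap.pi fun p => (φ p.1 (hpo p)).toLinearMap ∘ₗ
      LinearMap.proj (φ := fun p : Arin Λ x => Fin (M.d p.1) → k)
        (⟨p.1, Fin.cast (hc p).symm p.2⟩ : Arin Λ x)
  have hT : ∀ w p, T w p = φ p.1 (hpo p) (w ⟨p.1, Fin.cast (hc p).symm p.2⟩) := fun w p => rfl
  have hTι : ∀ v, T (ι v) = outMap (flipO x Λ) N x v := by
    intro v
    funext p
    rw [hT]
    exact hι v ⟨p.1, Fin.cast (hc p).symm p.2⟩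
  have hTinj : ∀ w, T w = 0 → w = 0 := by
    intro w hw
    funext p
    apply (φ p.1 (hp p)).injective
    have := congrFun hw ⟨p.1, Fin.cast (hc' p).symm p.2⟩
    rw [hT] at this
    simpa using this
  have hTsurj : Function.Surjective T := by
    intro w
    refine ⟨fun p => (φ p.1 (hp p)).symm (w ⟨p.1, Fin.cast (hc' p).symm p.2⟩), ?_⟩
    funext p
    rw [hT]
    simp
  let Q : (((p : Aout (flipO x Λ) x) → (Fin (N.d p.1) → k)) ⧸
      LinearMap.range (outMap (flipO x Λ) N x)) ≃ₗ[k] (Fin (M.d x) → k) :=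
    (cokerEquiv (flipO x Λ) N x).trans (castL k (if_pos rfl).symm)
  have hf : ∀ a (ha : a ≠ x) (i : Fin (Λ a x)) v, M.f a x i v =
      Q ((LinearMap.range (outMap (flipO x Λ) N x)).mkQ
        (Pi.single (⟨a, Fin.cast (hc' ⟨a, i⟩).symm i⟩ : Aout (flipO x Λ) x) (φ a ha v))) := by
    intro a ha i v
    have h1 : M.f a x i = (castL k (if_pos rfl).symm).toLinearMap ∘ₗ
          (cokerEquiv (flipO x Λ) N x).toLinearMap ∘ₗ
          (LinearMap.range (outMap (flipO x Λ) N x)).mkQ ∘ₗ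
          (LinearMap.single k (fun p : Aout (flipO x Λ) x => Fin (N.d p.1) → k)
            (⟨a, Fin.cast (hc' ⟨a, i⟩).symm i⟩ : Aout (flipO x Λ) x)) ∘ₗ
          (castL k (if_neg ha)).toLinearMap := by
      exact (dif_pos rfl).trans (dif_neg ha)
    rw [h1]
    rfl
  have hin : ∀ w, inMap Λ M x w = Q ((LinearMap.range (outMap (flipO x Λ) N x)).mkQ (T w)) := by
    intro w
    have key : inMap Λ M x = Q.toLinearMap ∘ₗ
        (LinearMap.range (outMap (flipO x Λ) N x)).mkQ ∘ₗ T := by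
      refine LinearMap.pi_ext fun p v => ?_
      rw [inMap_single, hf p.1 (hp p)]
      have : T (Pi.single p v) = Pi.single (cp p) (φ p.1 (hp p) v) := by
        funext q
        rw [hT]
        by_cases hq : q = cp p
        · subst hq
          simp [cp]
        · have h2 : (⟨q.1, Fin.cast (hc q).symm q.2⟩ : Arin Λ x) ≠ p := by
            rintro rfl
            exact hq rfl
          rw [Pi.single_eq_of_ne hq, Pi.single_eq_of_ne h2, map_zero]
      simp only [LinearMap.comp_apply, this]
      rfl
    rw [key]; rfl
  have hphi : ∀ a b (ha : a ≠ x) (hb : b ≠ x) (i : Fin (flipO x Λ a b)) v,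
      N.f a b i (φ a ha v) = φ b hb (M.f a b (Fin.cast (by simp [flipO, ha, hb]) i) v) := by
    intro a b ha hb i v
    have h1 : M.f a b (Fin.cast (by simp [flipO, ha, hb]) i) =
        (castL k (if_neg hb).symm).toLinearMap ∘ₗ N.f a b i ∘ₗ
          (castL k (if_neg ha)).toLinearMap := (dif_neg hb).trans (dif_neg ha)
    rw [h1]
    exact (castL_cast_symm (if_neg hb) (N.f a b i (φ a ha v))).symm
  refine ⟨⟨φ, hphi, ι, ?_, ?_, ?_, ?_⟩⟩
  · intro b hb i v
    exact (hι v ⟨b, Fin.cast (by simp [flipO]) i⟩).symm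
  · intro v w hvw
    apply hs
    rw [← hTι, ← hTι, hvw]
  · ext w
    rw [LinearMap.mem_ker, hin, LinearEquiv.map_eq_zero_iff, Submodule.mkQ_apply,
      Submodule.Quotient.mk_eq_zero]
    constructor
    · rintro ⟨v, rfl⟩
      exact ⟨v, (hTι v).symm⟩
    · rintro ⟨v, hv⟩
      refine ⟨v, ?_⟩
      rw [← hTι] at hv
      rw [← sub_eq_zero]
      apply hTinj
      rw [map_sub, hv, sub_self]
  · intro v
    obtain ⟨w, hw⟩ := Submodule.mkQ_surjective _ (Q.symm v)
    obtain ⟨t, rfl⟩ := hTsurj w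
    exact ⟨t, by rw [hin, hw, LinearEquiv.apply_symm_apply]⟩

theorem reflPlus_zero {x : Fin n} {Λ : Fin n → Fin n → ℕ} (hx : IsSink Λ x) (M : Rep k n Λ)
    (h : ∀ z, z ≠ x → M.d z = 0) : IsZeroRep (reflPlus x Λ M) := by
  intro z
  by_cases hz : z = x
  · have : (reflPlus x Λ M).d z = Module.finrank k (LinearMap.ker (inMap Λ M x)) := if_pos hz
    rw [this, Submodule.finrank_eq_zero, Submodule.eq_bot_iff]
    intro w _
    exact funext fun p => vec_zero_of (h _ (sink_arin_ne hx p)) _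
  · have : (reflPlus x Λ M).d z = M.d z := if_neg hz
    rw [this, h z hz]

theorem FList_zero : ∀ (S : List (Fin n)) (Λ : Fin n → Fin n → ℕ) (M : Rep k n Λ),
    Admissible Λ S → IsZeroRep M → IsZeroRep (FList S Λ M)
  | [], _, _, _, h => h
  | _ :: xs, _, M, ha, h => FList_zero xs _ _ ha.2 (reflPlus_zero ha.1 M fun z _ => h z)

theorem refl_up {x : Fin n} {Λ : Fin n → Fin n → ℕ} (hx : IsSink Λ x) {M : Rep k n Λ}
    (h : IdemIndec M) (hM : dimV M ≠ ee x) :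
    IdemIndec (reflPlus x Λ M) ∧ dimV (reflPlus x Λ M) = wSig Λ x (dimV M) := by
  have X := exPlus x Λ M (inMap_surj h hx hM)
  exact ⟨X.up hx h, X.dim hx⟩

theorem refl_simple {x : Fin n} {Λ : Fin n → Fin n → ℕ} (hx : IsSink Λ x) {M : Rep k n Λ}
    (hM : dimV M = ee x) : IsZeroRep (reflPlus x Λ M) := by
  refine reflPlus_zero hx M fun z hz => ?_
  have := congrFun hM z
  rw [ee_ne hz] at this
  simpa [dimV] using this

theorem refl_down {x : Fin n} {Λ : Fin n → Fin n → ℕ} (hx : IsSink Λ x) {N : Rep k n (flipO x Λ)}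
    (h : IdemIndec N) (hN : dimV N ≠ ee x) :
    ∃ M : Rep k n Λ, IdemIndec M ∧ dimV M = wSig Λ x (dimV N) := by
  obtain ⟨X⟩ := exMinus x Λ hx N (outMap_inj h hx hN)
  refine ⟨reflMinus x Λ N, X.down hx h, ?_⟩
  rw [X.dim hx, ← LinearEquiv.mul_apply, wSig_sq]
  rfl

theorem simple_indec (Λ : Fin n → Fin n → ℕ) (x : Fin n) :
    IdemIndec (simpleRep (k := k) Λ x) ∧ dimV (simpleRep (k := k) Λ x) = ee x := by
  have hd : (simpleRep (k := k) Λ x).d x = 1 := if_pos rfl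
  have hd0 : ∀ z, z ≠ x → (simpleRep (k := k) Λ x).d z = 0 := fun z hz => if_neg hz
  refine ⟨⟨fun h => ?_, fun e _ hi => ?_⟩, ?_⟩
  · have := h x
    omega
  · have h1 : Module.finrank k (Fin ((simpleRep (k := k) Λ x).d x) → k) = 1 := by simp [hd]
    obtain ⟨v, hv, hsp⟩ := finrank_eq_one_iff'.1 h1
    obtain ⟨c, hc⟩ := hsp (e x v)
    have h2 := hi x v
    rw [← hc, map_smul, ← hc, smul_smul] at h2
    have h3 : c * c = c := smul_left_injective k hv h2
    have h4 : ∀ u, e x u = c • u := by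
      intro u
      obtain ⟨t, rfl⟩ := hsp u
      rw [map_smul, ← hc, smul_comm]
    rcases (show c = 0 ∨ c = 1 by
      rw [← sub_eq_zero (b := (1 : k)), ← mul_eq_zero, mul_sub, h3, mul_one, sub_self]) with h5 | h5
    · left
      intro z u
      by_cases hz : z = x
      · subst hz; rw [h4, h5, zero_smul]
      · exact vec_zero_of (hd0 z hz) _
    · right
      intro z u
      by_cases hz : z = x
      · subst hz; rw [h4, h5, one_smul]
      · rw [vec_zero_of (hd0 z hz) u, map_zero]
  · funext z
    by_cases hz : z = x
    · subst hz; simp [dimV, hd, ee_self]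
    · simp [dimV, hd0 z hz, ee_ne hz]

end Refl

section Final

theorem run1 : ∀ (S : List (Fin n)) (Λ : Fin n → Fin n → ℕ) (M : Rep k n Λ),
    Admissible Λ S → IdemIndec M → Annihilates Λ S M →
    ∃ A y B, S = A ++ y :: B ∧ dimV M = act Λ A (ee y)
  | [], _, _, _, h, h0 => absurd h0 h.1
  | x :: xs, Λ, M, ha, h, h0 => by
    by_cases hM : dimV M = ee x
    · exact ⟨[], x, xs, rfl, by simpa using hM⟩
    · obtain ⟨hI, hd⟩ := refl_up ha.1 h hM
      obtain ⟨A, y, B, rfl, hA⟩ := run1 xs _ _ ha.2 hI h0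
      refine ⟨x :: A, y, B, rfl, ?_⟩
      rw [act_cons, LinearEquiv.mul_apply, ← act_flip x, ← hA, hd, ← LinearEquiv.mul_apply, wSig_sq]
      rfl

theorem run2 : ∀ (A : List (Fin n)) (y : Fin n) (B : List (Fin n)) (Λ : Fin n → Fin n → ℕ)
    (M : Rep k n Λ), Admissible Λ (A ++ y :: B) → IdemIndec M → dimV M = act Λ A (ee y) →
    Annihilates Λ (A ++ y :: B) M
  | [], y, B, Λ, M, ha, _, hd => FList_zero B _ _ ha.2 (refl_simple ha.1 (by simpa using hd))
  | x :: A, y, B, Λ, M, ha, h, hd => by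
    by_cases hM : dimV M = ee x
    · exact FList_zero (A ++ y :: B) _ _ ha.2 (refl_simple ha.1 hM)
    · obtain ⟨hI, hd'⟩ := refl_up ha.1 h hM
      refine run2 A y B _ _ ha.2 hI ?_
      rw [hd', hd, act_cons, act_flip, ← LinearEquiv.mul_apply, ← mul_assoc, wSig_sq, one_mul]

theorem run3 (C : List (Fin n)) (y : Fin n) : ∀ (A : List (Fin n)) (Λ : Fin n → Fin n → ℕ)
    (M : Rep k n Λ), Admissible Λ A → IdemIndec M → dimV M = act Λ (A ++ C) (ee y) →
    ¬ Annihilates Λ A M → ∀ j, 0 ≤ act Λ C (ee y) j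
  | [], Λ, M, _, _, hd, _ => fun j => by
    have hd' : dimV M = act Λ C (ee y) := hd
    rw [← hd']
    simp [dimV]
  | x :: A, Λ, M, ha, h, hd, hn => by
    by_cases hM : dimV M = ee x
    · exact absurd (FList_zero A _ _ ha.2 (refl_simple ha.1 hM)) hn
    · obtain ⟨hI, hd'⟩ := refl_up ha.1 h hM
      have := run3 C y A (flipO x Λ) _ ha.2 hI (by
        rw [hd', hd, List.cons_append, act_cons, act_flip, ← LinearEquiv.mul_apply, ← mul_assoc,
          wSig_sq, one_mul]) hn
      rwa [act_flip] at this

theorem build (y : Fin n) : ∀ (A : List (Fin n)) (Λ : Fin n → Fin n → ℕ),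
    Admissible Λ (A ++ [y]) → PosAll Λ (A ++ [y]) →
    ∃ M : Rep k n Λ, IdemIndec M ∧ dimV M = act Λ A (ee y)
  | [], Λ, _, _ => ⟨simpleRep Λ y, (simple_indec Λ y).1, (simple_indec Λ y).2⟩
  | x :: A, Λ, ha, hp => by
    obtain ⟨N, hN, hd⟩ := build y A (flipO x Λ) ha.2 (by
      intro A' C z B h
      rw [act_flip]
      exact hp (x :: A') C z B (by simp [h]))
    rw [act_flip] at hd
    obtain ⟨M, hM, hdM⟩ := refl_down ha.1 hN (by
      intro h
      have := hp [] (x :: A) y [] (by simp) x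
      rw [act_cons, LinearEquiv.mul_apply, ← hd, h, wSig_self, Pi.neg_apply, ee_self] at this
      omega)
    exact ⟨M, hM, by rw [hdM, hd, act_cons, LinearEquiv.mul_apply]⟩

theorem c_of_a {Λ : Fin n → Fin n → ℕ} {M : Rep k n Λ} {S : List (Fin n)} (hM : Indecomp M)
    (hS : IsShortestAnn Λ M S) :
    ∀ A C y, S = A ++ (C ++ [y]) → ∀ j, 0 ≤ act Λ C (ee y) j := by
  obtain ⟨hadm, hann, hmin⟩ := hS
  have hlen : ∀ A B, S = A ++ B → Annihilates Λ A M → B = [] := by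
    intro A B h hA
    subst h
    have := Sim.length_eq (hmin A hadm.left hA ⟨B, hadm.right, Relation.ReflTransGen.refl⟩)
    simpa using this
  obtain ⟨A₀, y₀, B₀, h0, hd⟩ := run1 S Λ M hadm hM.idem hann
  have hB : B₀ = [] := by
    refine hlen (A₀ ++ [y₀]) B₀ (by simp [h0]) (run2 A₀ y₀ [] Λ M ?_ hM.idem hd)
    subst h0
    exact Admissible.left (B := B₀) (by simpa using hadm)
  subst hB
  intro A C y h
  have h1 : A₀ ++ [y₀] = (A ++ C) ++ [y] := by rw [← h0, h]; simp
  obtain ⟨rfl, h2⟩ := List.append_inj' h1 rfl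
  obtain rfl : y₀ = y := by simpa using h2
  refine run3 C y₀ A Λ M ?_ hM.idem hd fun hA => ?_
  · rw [h] at hadm; exact hadm.left
  · have := hlen A _ h hA
    simp at this

theorem a_of_red {Λ : Fin n → Fin n → ℕ} {S : List (Fin n)} (hadm : Admissible Λ S) (hne : S ≠ [])
    (hQ : Qr Λ S) (hred : Red Λ S) :
    ∃ M : Rep k n Λ, Indecomp M ∧ Preprojective Λ M ∧ IsShortestAnn Λ M S := by
  obtain ⟨S₀, y, rfl⟩ := List.eq_nil_or_concat' S |>.resolve_left hne
  obtain ⟨M, hM, hd⟩ := build (k := k) y S₀ Λ hadm (posAll_of_red hred)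
  have hann := run2 S₀ y [] Λ M hadm hM hd
  refine ⟨M, hM.indecomp, ⟨_, hadm, hann⟩, hadm, hann, ?_⟩
  rintro S' hadm' hann' ⟨U, hU, hsim⟩
  rcases List.eq_nil_or_concat' U with rfl | ⟨U', u, rfl⟩
  · rw [List.append_nil] at hsim
    exact hsim.symm'
  exfalso
  have hl := (Qr.sim hsim hQ).2
  obtain rfl : y = u := by simpa [← List.append_assoc] using hl
  obtain ⟨A, z, B, rfl, hdA⟩ := run1 S' Λ M hadm' hM hann'
  have hT : Red Λ (A ++ z :: B ++ (U' ++ [y])) :=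
    Red.of_eq hred hsim.act_eq.symm hsim.length_eq.symm
  have hpos := posAll_of_red hT (A ++ [z]) (B ++ U') y [] (by simp) z
  have h1 := congrArg (fun g => g (ee y)) hsim.act_eq
  simp only [act_append, act_cons, act_nil, mul_one, LinearEquiv.mul_apply, wSig_self, map_neg,
    neg_inj] at h1
  rw [← hd, hdA] at h1
  have h2 := (act Λ A).injective h1
  have h3 := congrArg (wSig Λ z) h2
  rw [← LinearEquiv.mul_apply (wSig Λ z) (wSig Λ z), wSig_sq, wSig_self] at h3
  rw [act_append, LinearEquiv.mul_apply] at hpos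
  have h4 := congrFun h3 z
  simp only [Pi.neg_apply, ee_self, LinearEquiv.coe_one, id] at h4
  omega

end Final

theorem principal_sequence_reduced_tfae
    (n : ℕ) (hn : 2 ≤ n) (Λ : Fin n → Fin n → ℕ)
    (hloop : ∀ a, Λ a a = 0)
    (hconn : ∀ a b : Fin n, Relation.ReflTransGen (fun u v => edges Λ u v ≠ 0) a b)
    (hacyc : ∀ a : Fin n, ¬ Relation.TransGen (fun u v => Λ u v ≠ 0) a a)
    (k : Type) [Field k]
    (S : List (Fin n)) (hadm : Admissible Λ S) (hne : S ≠ [])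
    (hprin : IsPrincipal Λ S) :
    ((∃ M : Rep k n Λ, Indecomp M ∧ Preprojective Λ M ∧ IsShortestAnn Λ M S) ↔
        IsReducedSeq Λ S) ∧
    (IsReducedSeq Λ S ↔ ∀ i, 0 < i → i < S.length →
      (∀ j, 0 ≤ (((S.dropLast.drop (i-1)).map (wSig Λ)).prod)
          (Pi.single (S.getLast hne) (1 : ℤ)) j) ∧
      (((S.dropLast.drop (i-1)).map (wSig Λ)).prod)
          (Pi.single (S.getLast hne) (1 : ℤ)) ≠ 0) := by
  have hQ : Qr Λ S := Qr_principal Λ hn hloop hconn S hprin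
  have hcb : (∀ A C y, S = A ++ (C ++ [y]) → ∀ j, 0 ≤ act Λ C (ee y) j) → Red Λ S := fun h =>
    red_of_posL Λ S (posAll_of_c S Λ hadm hQ h).posL
  rw [isReducedSeq_iff]
  refine ⟨⟨?_, a_of_red hadm hne hQ⟩, ?_, ?_⟩
  · rintro ⟨M, hM, -, hS⟩
    exact hcb (c_of_a hM hS)
  · intro hred i hi hil
    refine ⟨?_, act_ee_ne Λ (S.dropLast.drop (i-1)) (S.getLast hne)⟩
    refine posAll_of_red hred (S.dropLast.take (i-1)) (S.dropLast.drop (i-1)) (S.getLast hne) [] ?_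
    rw [← List.append_assoc, List.take_append_drop, List.dropLast_append_getLast]
  · intro hc
    refine hcb fun A C y h => ?_
    by_cases hC : C = []
    · subst hC
      intro j
      exact ee_nonneg y j
    have hpos : 0 < C.length := List.length_pos_of_ne_nil hC
    have := (hc (A.length + 1) (Nat.succ_pos _) (by rw [h]; simp; omega)).1
    have h1 : S.dropLast = A ++ C := by rw [h, ← List.append_assoc]; simp
    have h2 : S.getLast hne = y := by simp [h]
    rw [h1, h2] at this
    rw [Nat.add_sub_cancel, List.drop_left] at this
    exact this

end KP
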